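/- For k ≥ 2, let T be a feasible connected digraph of order k. Suppose n·rₙ² → 0 and ln n = o(n^{2k−1}·rₙ^{4(k−1)}) as n → ∞. Then, almost surely, n^{−k}·rₙ^{−2(k−1)}·H̃_{n,T} → μ_T as n → ∞. -/

import Mathlib

open MeasureTheory ProbabilityTheory Filter Real Set
open scoped Topology

noncomputable section

/-- The circular sector with apex `x`, radius `r`, central angle `a` and
inclination `y` (measured anticlockwise from the horizontal direction). -/
def sector (a : ℝ) (x : ℂ) (y r : ℝ) : Set ℂ :=
  {z : ℂ | ‖z - x‖ ≤ r ∧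
    ∃ t : ℝ, y ≤ t ∧ t ≤ y + a ∧
      z - x = (‖z - x‖ : ℂ) * Complex.exp (t * Complex.I)}

/-- Arc relation of the sector digraph on the configuration `x` (points) and `y`
(inclinations) with cutoff `r`: there is an arc from `i` to `j` iff `i ≠ j` and
the point `x j` lies in the sector of `i`. -/
def arc (a r : ℝ) {n : ℕ} (x : Fin n → ℂ) (y : Fin n → ℝ) (i j : Fin n) : Prop :=
  i ≠ j ∧ x j ∈ sector a (x i) (y i) r

/-- The sector digraph (cutoff `r`) on the `k`-point configuration `(x, y)` is
isomorphic to the digraph `T` on `Fin k`. -/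
def isoT (a r : ℝ) {k : ℕ} (T : Fin k → Fin k → Prop) (x : Fin k → ℂ) (y : Fin k → ℝ) : Prop :=
  ∃ e : Equiv.Perm (Fin k), ∀ i j, T i j ↔ arc a r x y (e i) (e j)

/-- The number of induced subdigraphs of the sector digraph on the configuration
`(x, y)` with cutoff `r` that are isomorphic to `T`. -/
def inducedCount (a r : ℝ) {k : ℕ} (T : Fin k → Fin k → Prop) {n : ℕ}
    (x : Fin n → ℂ) (y : Fin n → ℝ) : ℕ :=
  Set.ncard {s : Finset (Fin n) |
    ∃ g : Fin k ↪ Fin n, Finset.univ.map g = s ∧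
      ∀ i j, T i j ↔ arc a r x y (g i) (g j)}

/-- The number of isolated induced subdigraphs of the sector digraph on the
configuration `(x, y)` with cutoff `r` that are isomorphic to `T`: `k`-element
vertex subsets inducing a digraph isomorphic to `T` with no arc leaving the subset. -/
def isolatedCount (a r : ℝ) {k : ℕ} (T : Fin k → Fin k → Prop) {n : ℕ}
    (x : Fin n → ℂ) (y : Fin n → ℝ) : ℕ :=
  Set.ncard {s : Finset (Fin n) |
    (∃ g : Fin k ↪ Fin n, Finset.univ.map g = s ∧
      ∀ i j, T i j ↔ arc a r x y (g i) (g j)) ∧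
    ∀ i ∈ s, ∀ j, j ∉ s → ¬ arc a r x y i j}

open Classical in
/-- The indicator function `h_T`: equal to `1` if the sector digraph with radius `1`
on the configuration `(x, y)` is isomorphic to `T`, and `0` otherwise. -/
def hInd (a : ℝ) {k : ℕ} (T : Fin k → Fin k → Prop) (x : Fin k → ℂ) (y : Fin k → ℝ) : ℝ :=
  if isoT a 1 T x y then 1 else 0

/-- The `k`-point configuration `(0, z 1, …, z (k-1))`. -/
def pts {k : ℕ} (z : Fin (k - 1) → ℂ) (i : Fin k) : ℂ :=
  if h : (i : ℕ) = 0 then 0 else z ⟨(i : ℕ) - 1, by have := i.isLt; omega⟩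

/-- The Lebesgue measure of `S(x₁,…,x_k,y₁,…,y_k) = ∪_{i=1}^k S(xᵢ,yᵢ,1)`. -/
def sectorUnionVol (a : ℝ) {k : ℕ} (x : Fin k → ℂ) (y : Fin k → ℝ) : ℝ :=
  (volume (⋃ i, sector a (x i) (y i) 1)).toReal

/-- The function `φ_T`. -/
def phiT (a : ℝ) (k : ℕ) (T : Fin k → Fin k → Prop) (t : ℝ) : ℝ :=
  if k = 1 then Real.exp (-(t * a) / 2)
  else (t ^ (k - 1) / ((k - 1).factorial * (2 * π) ^ k)) *
    ∫ y in Set.univ.pi (fun _ : Fin k => Set.Ico 0 (2 * π)),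
      ∫ z : Fin (k - 1) → ℂ,
        hInd a T (pts z) y * Real.exp (-t * sectorUnionVol a (pts z) y)

/-- The constant `μ_T`. -/
def muT (a : ℝ) (k : ℕ) (T : Fin k → Fin k → Prop) (f : ℂ → ℝ) : ℝ :=
  (1 / (k.factorial * (2 * π) ^ k)) *
    ∫ y in Set.univ.pi (fun _ : Fin k => Set.Ico 0 (2 * π)),
      ∫ z : Fin (k - 1) → ℂ, ∫ x : ℂ, hInd a T (pts z) y * f x ^ k

/-- A McDiarmid-type bounded differences inequality in subgaussian form. -/
theorem mcd {E : Type*} [MeasurableSpace E] (ν : Measure E) [IsProbabilityMeasure ν] (c : NNReal) :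
    ∀ (n : ℕ) (F : (Fin n → E) → ℝ), Measurable F → (∃ B, ∀ w, |F w| ≤ B) →
      (∀ w i v, |F (Function.update w i v) - F w| ≤ c) →
      HasSubgaussianMGF (fun w => F w - ∫ w, F w ∂(Measure.pi fun _ : Fin n => ν)) (n * c ^ 2)
        (Measure.pi fun _ : Fin n => ν) := by
  intro n
  induction n with
  | zero =>
    intro F hF _ _
    have h0 : (fun w => F w - ∫ w, F w ∂(Measure.pi fun _ : Fin 0 => ν)) = fun _ => (0:ℝ) := by
      funext w
      have : F = fun _ => F w := by funext u; congr 1; exact Subsingleton.elim _ _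
      rw [this]; simp
    rw [h0]
    simpa using (HasSubgaussianMGF.fun_zero (μ := Measure.pi fun _ : Fin 0 => ν))
  | succ n ih =>
    intro F hF ⟨B, hB⟩ hd
    obtain ⟨y0⟩ : Nonempty E := ν.nonempty_of_neZero
    set e := MeasurableEquiv.piFinSuccAbove (fun _ : Fin (n+1) => E) 0 with he
    have hmp : MeasurePreserving e (Measure.pi fun _ : Fin (n+1) => ν)
        (ν.prod (Measure.pi fun _ : Fin n => ν)) :=
      measurePreserving_piFinSuccAbove (fun _ : Fin (n+1) => ν) 0
    have hes : ∀ y x, e.symm (y, x) = Fin.cons y x := by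
      intro y x; simp [he, MeasurableEquiv.piFinSuccAbove, Fin.insertNth_zero]
      rfl
    have hFc : Measurable (fun p : E × (Fin n → E) => F (Fin.cons p.1 p.2)) := by
      have : (fun p : E × (Fin n → E) => F (Fin.cons p.1 p.2)) = F ∘ e.symm := by
        funext p; simp [← hes]
      rw [this]; exact hF.comp e.symm.measurable
    set G : (Fin n → E) → ℝ := fun x => ∫ y, F (Fin.cons y x) ∂ν with hG
    have hGm : Measurable G := by
      have : StronglyMeasurable (fun p : (Fin n → E) × E => F (Fin.cons p.2 p.1)) :=
        (hFc.comp measurable_swap).stronglyMeasurable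
      exact this.integral_prod_right.measurable
    have hInte : ∀ x, Integrable (fun y => F (Fin.cons y x)) ν := by
      intro x
      refine Integrable.of_bound (C := B) ?_ ?_
      · exact (hFc.comp (measurable_id.prodMk measurable_const)).aestronglyMeasurable
      · exact ae_of_all _ fun y => hB _
    have hGb : ∀ w, |G w| ≤ B := by
      intro x
      have := norm_integral_le_of_norm_le_const (μ := ν) (f := fun y => F (Fin.cons y x)) (C := B)
        (ae_of_all _ fun y => hB _)
      simpa using this
    have hGd : ∀ w i v, |G (Function.update w i v) - G w| ≤ c := by
      intro x i v
      rw [hG]; dsimp only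
      rw [← integral_sub (hInte _) (hInte _)]
      have := norm_integral_le_of_norm_le_const (μ := ν)
        (f := fun y => F (Fin.cons y (Function.update x i v)) - F (Fin.cons y x)) (C := c)
        (ae_of_all _ fun y => by rw [Fin.cons_update]; exact hd _ _ _)
      simpa using this
    have IH := ih G hGm ⟨B, hGb⟩ hGd
    have hFi : ∀ t : ℝ, Integrable (fun p : E × (Fin n → E) => Real.exp (t * F (Fin.cons p.1 p.2)))
        (ν.prod (Measure.pi fun _ : Fin n => ν)) := by
      intro t
      refine Integrable.of_bound (C := Real.exp (|t| * B)) ?_ ?_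
      · exact (Real.measurable_exp.comp (hFc.const_mul t)).aestronglyMeasurable
      · refine ae_of_all _ fun p => ?_
        rw [Real.norm_eq_abs, abs_of_pos (Real.exp_pos _)]
        apply Real.exp_le_exp.2
        refine (le_abs_self _).trans ?_
        rw [abs_mul]
        exact mul_le_mul_of_nonneg_left (hB _) (abs_nonneg _)
    have hEF : ∫ w, F w ∂(Measure.pi fun _ : Fin (n+1) => ν)
        = ∫ x, G x ∂(Measure.pi fun _ : Fin n => ν) := by
      rw [← (hmp.symm).integral_comp']
      simp_rw [show ∀ p : E × (Fin n → E), e.symm p = Fin.cons p.1 p.2 from fun p => hes p.1 p.2]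
      rw [integral_prod_symm]
      refine Integrable.of_bound (C := B) hFc.aestronglyMeasurable (ae_of_all _ fun p => hB _)
    set m := ∫ x, G x ∂(Measure.pi fun _ : Fin n => ν) with hm
    constructor
    · intro t
      rw [hEF]
      rw [← (hmp.symm).integrable_comp_emb e.symm.measurableEmbedding]
      have : ((fun ω => Real.exp (t * (F ω - m))) ∘ e.symm) =
          fun p : E × (Fin n → E) => Real.exp (t * F (Fin.cons p.1 p.2)) * Real.exp (- (t * m)) := by
        funext p
        simp only [Function.comp]
        rw [show e.symm p = Fin.cons p.1 p.2 from hes p.1 p.2, ← Real.exp_add]; congr 1; ring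
      rw [this]
      exact (hFi t).mul_const _
    · intro t
      rw [hEF]
      unfold mgf
      rw [← (hmp.symm).integral_comp']
      simp_rw [show ∀ p : E × (Fin n → E), e.symm p = Fin.cons p.1 p.2 from fun p => hes p.1 p.2]
      rw [integral_prod_symm]
      swap
      · have : (fun p : E × (Fin n → E) => Real.exp (t * (F (Fin.cons p.1 p.2) - m))) =
          fun p : E × (Fin n → E) => Real.exp (t * F (Fin.cons p.1 p.2)) * Real.exp (- (t * m)) := by
          funext p
          rw [← Real.exp_add]; congr 1; ring
        rw [this]
        exact (hFi t).mul_const _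
      have hin : ∀ x, ∫ y, Real.exp (t * (F (Fin.cons y x) - m)) ∂ν ≤
          Real.exp (t * (G x - m)) * Real.exp (c ^ 2 * t ^ 2 / 2) := by
        intro x
        have h1 := hasSubgaussianMGF_of_mem_Icc (μ := ν) (X := fun y => F (Fin.cons y x))
          (a := F (Fin.cons y0 x) - c) (b := F (Fin.cons y0 x) + c)
          ((hFc.comp (measurable_id.prodMk measurable_const)).aemeasurable)
          (ae_of_all _ fun y => by
            have := hd (Fin.cons y0 x) 0 y
            rw [Fin.update_cons_zero, abs_le] at this
            constructor <;> linarith [this.1, this.2])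
        have h2 := h1.mgf_le t
        unfold mgf at h2
        have h3 : ∀ y, Real.exp (t * (F (Fin.cons y x) - m)) = Real.exp (t * (G x - m)) *
          Real.exp (t * (F (Fin.cons y x) - ∫ y, F (Fin.cons y x) ∂ν)) := by
          intro y; rw [← Real.exp_add]; congr 1; simp only [hG]; ring
        simp_rw [h3]
        rw [integral_const_mul]
        refine mul_le_mul_of_nonneg_left (h2.trans (le_of_eq ?_)) (Real.exp_pos _).le
        congr 3
        push_cast
        have : F (Fin.cons y0 x) + ↑c - (F (Fin.cons y0 x) - ↑c) = 2 * c := by ring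
        rw [this, Real.norm_eq_abs, abs_of_nonneg (by positivity)]; ring
      refine (integral_mono ?_ ?_ hin).trans ?_
      · refine Integrable.of_bound (C := Real.exp (|t| * (B + |m|))) ?_ (ae_of_all _ fun x => ?_)
        · have : StronglyMeasurable (fun p : (Fin n → E) × E => Real.exp (t * (F (Fin.cons p.2 p.1) - m))) :=
            (Real.measurable_exp.comp (((hFc.comp measurable_swap).sub_const m).const_mul t)).stronglyMeasurable
          exact this.integral_prod_right.aestronglyMeasurable
        · have := norm_integral_le_of_norm_le_const (μ := ν) (f := fun y => Real.exp (t * (F (Fin.cons y x) - m)))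
            (C := Real.exp (|t| * (B + |m|))) (ae_of_all _ fun y => by
              rw [Real.norm_eq_abs, abs_of_pos (Real.exp_pos _)]
              apply Real.exp_le_exp.2
              refine (le_abs_self _).trans ?_
              rw [abs_mul]
              refine mul_le_mul_of_nonneg_left ?_ (abs_nonneg _)
              exact (abs_sub _ _).trans (add_le_add (hB _) le_rfl))
          simpa using this
      · exact (IH.integrable_exp_mul t).mul_const _
      · rw [integral_mul_const]
        have := IH.mgf_le t
        unfold mgf at this
        refine (mul_le_mul_of_nonneg_right this (Real.exp_pos _).le).trans (le_of_eq ?_)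
        rw [← Real.exp_add]; congr 1; push_cast; ring

/-- Two-sided tail bound. -/
theorem mcd_tail {E : Type*} [MeasurableSpace E] (ν : Measure E) [IsProbabilityMeasure ν] (c : NNReal)
    (n : ℕ) (F : (Fin n → E) → ℝ) (hF : Measurable F) (hB : ∃ B, ∀ w, |F w| ≤ B)
    (hd : ∀ w i v, |F (Function.update w i v) - F w| ≤ c) (s : ℝ) (hs : 0 ≤ s) :
    (Measure.pi fun _ : Fin n => ν).real
      {w | s ≤ |F w - ∫ w, F w ∂(Measure.pi fun _ : Fin n => ν)|} ≤
      2 * Real.exp (- s ^ 2 / (2 * (n * c ^ 2))) := by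
  have h := mcd ν c n F hF hB hd
  have h1 := h.measure_ge_le hs
  have h2 := h.neg.measure_ge_le hs
  have hsub : {w | s ≤ |F w - ∫ w, F w ∂(Measure.pi fun _ : Fin n => ν)|} ⊆
     {w | s ≤ F w - ∫ w, F w ∂(Measure.pi fun _ : Fin n => ν)} ∪
     {w | s ≤ (-(fun w => F w - ∫ w, F w ∂(Measure.pi fun _ : Fin n => ν))) w} := by
    intro w hw
    simp only [mem_ofPred_eq, mem_union, Pi.neg_apply] at hw ⊢
    exact le_abs.1 hw
  refine (measureReal_mono hsub).trans ((measureReal_union_le _ _).trans ?_)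
  push_cast at h1 h2
  linarith

/-- `s` induces a copy of `T` in the configuration `w`. -/
def indT (a r : ℝ) {k : ℕ} (T : Fin k → Fin k → Prop) {n : ℕ} (w : Fin n → ℂ × ℝ)
    (s : Finset (Fin n)) : Prop :=
  ∃ g : Fin k ↪ Fin n, Finset.univ.map g = s ∧
      ∀ i j, T i j ↔ arc a r (fun i => (w i).1) (fun i => (w i).2) (g i) (g j)

/-- No arc leaves `s`. -/
def isoS (a r : ℝ) {n : ℕ} (w : Fin n → ℂ × ℝ) (s : Finset (Fin n)) : Prop :=
  ∀ i ∈ s, ∀ j, j ∉ s → ¬ arc a r (fun i => (w i).1) (fun i => (w i).2) i j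

open Classical in
/-- indices of points within `ρ` of the `i`-th point. -/
def nb (ρ : ℝ) {n : ℕ} (w : Fin n → ℂ × ℝ) (i : Fin n) : Finset (Fin n) :=
  Finset.univ.filter fun j => dist (w j).1 (w i).1 ≤ ρ

open Classical in
/-- truncated family of isolated sets. -/
def Fam (a r : ℝ) {k : ℕ} (T : Fin k → Fin k → Prop) (m : ℕ) {n : ℕ} (w : Fin n → ℂ × ℝ) :
    Finset (Finset (Fin n)) :=
  Finset.univ.filter fun s => indT a r T w s ∧ isoS a r w s ∧
    ∀ i ∈ s, (nb ((k + 1) * r) w i).card ≤ m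

theorem arc_dist {a r : ℝ} {n : ℕ} {x : Fin n → ℂ} {y : Fin n → ℝ} {i j : Fin n}
    (h : arc a r x y i j) : dist (x j) (x i) ≤ r := by
  rw [dist_eq_norm]; exact h.2.1

theorem conn_dist {a r : ℝ} (hr : 0 ≤ r) {k n : ℕ} {T : Fin k → Fin k → Prop}
    (hT : (SimpleGraph.fromRel T).Connected)
    (x : Fin n → ℂ) (y : Fin n → ℝ) (g : Fin k → Fin n)
    (hg : ∀ i j, T i j ↔ arc a r x y (g i) (g j)) (i j : Fin k) :
    dist (x (g i)) (x (g j)) ≤ k * r := by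
  have key : ∀ (u v : Fin k) (p : (SimpleGraph.fromRel T).Walk u v),
      dist (x (g u)) (x (g v)) ≤ p.length * r := by
    intro u v p
    induction p with
    | nil => simp
    | @cons u b c h p ih =>
      have h1 : dist (x (g u)) (x (g b)) ≤ r := by
        rw [SimpleGraph.fromRel_adj] at h
        rcases h.2 with h | h
        · rw [dist_comm]; exact arc_dist ((hg _ _).1 h)
        · exact arc_dist ((hg _ _).1 h)
      have := dist_triangle (x (g u)) (x (g b)) (x (g c))
      rw [SimpleGraph.Walk.length_cons]; push_cast
      linarith
  obtain ⟨p, hp⟩ := hT.exists_isPath i j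
  refine (key i j p).trans ?_
  have := hp.length_lt
  rw [Fintype.card_fin] at this
  have : (p.length : ℝ) ≤ k := by exact_mod_cast this.le
  gcongr

theorem indT_card {a r : ℝ} {k n : ℕ} {T : Fin k → Fin k → Prop} {w : Fin n → ℂ × ℝ}
    {s : Finset (Fin n)} (h : indT a r T w s) : s.card = k := by
  obtain ⟨g, rfl, -⟩ := h
  simp

theorem indT_dist {a r : ℝ} (hr : 0 ≤ r) {k n : ℕ} {T : Fin k → Fin k → Prop}
    (hT : (SimpleGraph.fromRel T).Connected) {w : Fin n → ℂ × ℝ}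
    {s : Finset (Fin n)} (h : indT a r T w s) {i j : Fin n} (hi : i ∈ s) (hj : j ∈ s) :
    dist (w i).1 (w j).1 ≤ k * r := by
  obtain ⟨g, rfl, hg⟩ := h
  simp only [Finset.mem_map, Finset.mem_univ, true_and] at hi hj
  obtain ⟨i', rfl⟩ := hi
  obtain ⟨j', rfl⟩ := hj
  exact conn_dist hr hT (fun i => (w i).1) (fun i => (w i).2) g hg i' j'

theorem isolatedCount_eq (a r : ℝ) {k : ℕ} (T : Fin k → Fin k → Prop) {n : ℕ} (w : Fin n → ℂ × ℝ)
    (m : ℕ) (hw : ∀ i, (nb ((k + 1) * r) w i).card ≤ m) :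
    isolatedCount a r T (fun i => (w i).1) (fun i => (w i).2) = (Fam a r T m w).card := by
  classical
  unfold isolatedCount Fam
  rw [← Set.ncard_coe_finset]
  congr 1
  ext s
  simp only [Finset.coe_filter, Finset.mem_univ, true_and]
  constructor
  · rintro ⟨h1, h2⟩; exact ⟨h1, h2, fun i _ => hw i⟩
  · rintro ⟨h1, h2, _⟩; exact ⟨h1, h2⟩

theorem exists_cover : ∃ D : ℕ, ∀ (x : ℂ) (ρ : ℝ), 0 < ρ → ∃ t : Finset ℂ, t.card ≤ D ∧
    ∀ z, dist z x ≤ ρ → ∃ c ∈ t, dist z c ≤ ρ / 2 := by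
  classical
  have hc : TotallyBounded (Metric.closedBall (0:ℂ) 1) := (isCompact_closedBall 0 1).totallyBounded
  obtain ⟨t, ht, htc⟩ := Metric.totallyBounded_iff.1 hc (1/2) (by norm_num)
  refine ⟨ht.toFinset.card, fun x ρ hρ => ⟨ht.toFinset.image (fun c => x + ρ * c),
    Finset.card_image_le, fun z hz => ?_⟩⟩
  have hρ' : (ρ : ℂ) ≠ 0 := by exact_mod_cast hρ.ne'
  have hmem : (z - x) / ρ ∈ Metric.closedBall (0:ℂ) 1 := by
    rw [mem_closedBall_zero_iff, norm_div, Complex.norm_real, Real.norm_eq_abs, abs_of_pos hρ,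
      div_le_one hρ, ← dist_eq_norm]
    exact hz
  have := htc hmem
  simp only [mem_iUnion, exists_prop] at this
  obtain ⟨c, hct, hcd⟩ := this
  refine ⟨x + ρ * c, Finset.mem_image_of_mem _ (ht.mem_toFinset.2 hct), ?_⟩
  rw [Metric.mem_ball, dist_eq_norm] at hcd
  rw [dist_eq_norm]
  have : z - (x + ρ * c) = ρ * ((z - x) / ρ - c) := by field_simp; ring
  rw [this, norm_mul, Complex.norm_real, Real.norm_eq_abs, abs_of_pos hρ]
  nlinarith

theorem indT_congr {a r : ℝ} {k n : ℕ} {T : Fin k → Fin k → Prop} {w w' : Fin n → ℂ × ℝ}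
    {s : Finset (Fin n)} (hs : ∀ i ∈ s, w i = w' i) (h : indT a r T w s) : indT a r T w' s := by
  obtain ⟨g, rfl, hg⟩ := h
  refine ⟨g, rfl, fun i j => ?_⟩
  rw [hg]
  unfold arc
  simp only [hs (g i) (by simp), hs (g j) (by simp)]

theorem Fam_sdiff {D : ℕ} (hD : ∀ (x : ℂ) (ρ : ℝ), 0 < ρ → ∃ t : Finset ℂ, t.card ≤ D ∧
    ∀ z, dist z x ≤ ρ → ∃ c ∈ t, dist z c ≤ ρ / 2)
    {a r : ℝ} (hr : 0 < r) {k n : ℕ} (hk : 2 ≤ k) {T : Fin k → Fin k → Prop}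
    (hT : (SimpleGraph.fromRel T).Connected) (m : ℕ) (w : Fin n → ℂ × ℝ) (i : Fin n) (v : ℂ × ℝ) :
    (Fam a r T m w \ Fam a r T m (Function.update w i v)).card ≤ (D * m + 1) * m ^ k := by
  classical
  set w' := Function.update w i v with hw'
  set ρ : ℝ := (k + 1) * r with hρ
  have hρ0 : 0 < ρ := by positivity
  have hρr : r ≤ ρ := by rw [hρ]; nlinarith [(Nat.cast_nonneg k : (0:ℝ) ≤ k)]
  have hρk : k * r ≤ ρ := by rw [hρ]; nlinarith
  set Q : Finset (Fin n) := Finset.univ.filter fun s => (nb ρ w s).card ≤ m ∧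
    dist (w s).1 v.1 ≤ ρ with hQ
  set Q' : Finset (Fin n) := Finset.univ.filter fun s => (nb ρ w s).card ≤ m ∧ s = i with hQ'
  have hsub : Fam a r T m w \ Fam a r T m w' ⊆
      (Q ∪ Q').biUnion fun s => Finset.powersetCard k (nb ρ w s) := by
    intro S hS
    rw [Finset.mem_sdiff] at hS
    obtain ⟨hS1, hS2⟩ := hS
    simp only [Fam, Finset.mem_filter, Finset.mem_univ, true_and] at hS1 hS2
    obtain ⟨h1, h2, h3⟩ := hS1
    have hmem : ∀ s ∈ S, S ∈ Finset.powersetCard k (nb ρ w s) := by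
      intro s hs
      rw [Finset.mem_powersetCard]
      refine ⟨fun j hj => ?_, indT_card h1⟩
      simp only [nb, Finset.mem_filter, Finset.mem_univ, true_and]
      exact (indT_dist hr.le hT h1 hj hs).trans hρk
    rw [Finset.mem_biUnion]
    by_cases hi : i ∈ S
    · exact ⟨i, Finset.mem_union_right _ (by simp [hQ', h3 i hi, hρ]), hmem i hi⟩
    · have hne : ∀ j ∈ S, j ≠ i := fun j hj h => hi (h ▸ hj)
      have heq : ∀ j, j ≠ i → w' j = w j := fun j hj => by simp [hw', Function.update_of_ne hj]
      have hwi : w' i = v := by simp [hw']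
      suffices h : ∃ s ∈ S, dist (w s).1 v.1 ≤ ρ by
        obtain ⟨s, hs, hd⟩ := h
        refine ⟨s, Finset.mem_union_left _ ?_, hmem s hs⟩
        simp only [hQ, Finset.mem_filter, Finset.mem_univ, true_and]
        exact ⟨h3 s hs, hd⟩
      by_contra hcon
      push Not at hcon
      refine hS2 ⟨indT_congr (fun j hj => (heq j (hne j hj)).symm) h1, ?_, ?_⟩
      · intro s hs j hj harc
        by_cases hji : j = i
        · have := arc_dist harc
          simp only [hji, hwi, heq s (hne s hs)] at this
          have h5 := hcon s hs
          rw [dist_comm] at this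
          linarith
        · refine h2 s hs j hj ?_
          unfold arc at harc ⊢
          simpa only [heq s (hne s hs), heq j hji] using harc
      · intro s hs
        refine (Finset.card_le_card ?_).trans (h3 s hs)
        intro j hj
        simp only [nb, Finset.mem_filter, Finset.mem_univ, true_and] at hj ⊢
        rw [heq s (hne s hs)] at hj
        by_cases hji : j = i
        · rw [hji, hwi, dist_comm] at hj
          have := hcon s hs
          linarith
        · rwa [heq j hji] at hj
  have hQc : Q.card ≤ D * m := by
    obtain ⟨t, htD, ht⟩ := hD v.1 ρ hρ0
    have : Q ⊆ t.biUnion fun c => Q.filter fun s => dist (w s).1 c ≤ ρ / 2 := by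
      intro s hs
      have hs' := hs
      simp only [hQ, Finset.mem_filter, Finset.mem_univ, true_and] at hs'
      obtain ⟨c, hc, hd⟩ := ht _ hs'.2
      rw [Finset.mem_biUnion]
      exact ⟨c, hc, Finset.mem_filter.2 ⟨hs, hd⟩⟩
    refine (Finset.card_le_card this).trans ((Finset.card_biUnion_le_card_mul _ _ m ?_).trans
      (Nat.mul_le_mul_right _ htD))
    intro c _
    rcases (Q.filter fun s => dist (w s).1 c ≤ ρ / 2).eq_empty_or_nonempty with h | ⟨s, hs⟩
    · rw [h]; simp
    · rw [Finset.mem_filter] at hs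
      have hs' := hs.1
      simp only [hQ, Finset.mem_filter, Finset.mem_univ, true_and] at hs'
      refine (Finset.card_le_card ?_).trans hs'.1
      intro j hj
      rw [Finset.mem_filter] at hj
      simp only [nb, Finset.mem_filter, Finset.mem_univ, true_and]
      have := dist_triangle_right (w j).1 (w s).1 c
      linarith [hj.2, hs.2]
  have hQ'c : Q'.card ≤ 1 := by
    rw [Finset.card_le_one]
    intro x hx y hy
    simp only [hQ', Finset.mem_filter, Finset.mem_univ, true_and] at hx hy
    rw [hx.2, hy.2]
  refine (Finset.card_le_card hsub).trans ((Finset.card_biUnion_le_card_mul _ _ (m ^ k) ?_).trans ?_)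
  · intro s hs
    rw [Finset.card_powersetCard]
    have : (nb ρ w s).card ≤ m := by
      rcases Finset.mem_union.1 hs with h | h
      · exact (Finset.mem_filter.1 h).2.1
      · exact (Finset.mem_filter.1 h).2.1
    exact (Nat.choose_le_pow _ _).trans (Nat.pow_le_pow_left this _)
  · refine Nat.mul_le_mul_right _ ((Finset.card_union_le _ _).trans (add_le_add hQc hQ'c))

theorem Fam_diff {D : ℕ} (hD : ∀ (x : ℂ) (ρ : ℝ), 0 < ρ → ∃ t : Finset ℂ, t.card ≤ D ∧
    ∀ z, dist z x ≤ ρ → ∃ c ∈ t, dist z c ≤ ρ / 2)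
    {a r : ℝ} (hr : 0 < r) {k n : ℕ} (hk : 2 ≤ k) {T : Fin k → Fin k → Prop}
    (hT : (SimpleGraph.fromRel T).Connected) (m : ℕ) (w : Fin n → ℂ × ℝ) (i : Fin n) (v : ℂ × ℝ) :
    |((Fam a r T m (Function.update w i v)).card : ℝ) - (Fam a r T m w).card|
      ≤ (((D * m + 1) * m ^ k : ℕ) : ℝ) := by
  classical
  have h1 := Fam_sdiff hD hr hk hT m w i v (a := a)
  have h2 := Fam_sdiff hD hr hk hT m (Function.update w i v) i (w i) (a := a)
  rw [Function.update_idem, Function.update_eq_self] at h2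
  have h3 := Finset.le_card_sdiff (Fam a r T m (Function.update w i v)) (Fam a r T m w)
  have h4 := Finset.le_card_sdiff (Fam a r T m w) (Fam a r T m (Function.update w i v))
  rw [abs_le]
  have h5 : (Fam a r T m w).card ≤ (Fam a r T m (Function.update w i v)).card + (D * m + 1) * m ^ k := by
    omega
  have h6 : (Fam a r T m (Function.update w i v)).card ≤ (Fam a r T m w).card + (D * m + 1) * m ^ k := by
    omega
  have h5' := (Nat.cast_le (α := ℝ)).2 h5
  have h6' := (Nat.cast_le (α := ℝ)).2 h6
  rw [Nat.cast_add] at h5' h6'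
  constructor <;> linarith

theorem isClosed_sec (a : ℝ) : IsClosed {p : ℂ × ℝ | ∃ t : ℝ, p.2 ≤ t ∧ t ≤ p.2 + a ∧
      p.1 = (‖p.1‖ : ℂ) * Complex.exp (t * Complex.I)} := by
  have hcl : IsClosed {q : (ℂ × ℝ) × (Icc (0:ℝ) a) |
      q.1.1 = (‖q.1.1‖ : ℂ) * Complex.exp (((q.1.2 + (q.2 : ℝ) : ℝ) : ℂ) * Complex.I)} := by
    apply isClosed_eq
    · fun_prop
    · fun_prop
  have := isClosedMap_fst_of_compactSpace _ hcl
  convert this using 1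
  ext p
  simp only [mem_ofPred_eq, mem_image]
  constructor
  · rintro ⟨t, h1, h2, h3⟩
    refine ⟨(p, ⟨t - p.2, by constructor <;> linarith⟩), ?_, rfl⟩
    simpa using h3
  · rintro ⟨⟨q, s⟩, h, rfl⟩
    exact ⟨q.2 + s, by linarith [s.2.1], by linarith [s.2.2], h⟩

theorem measurable_arc {Ω : Type*} [MeasurableSpace Ω] (a r : ℝ) {n : ℕ} {x : Ω → Fin n → ℂ}
    {y : Ω → Fin n → ℝ} (hx : Measurable x) (hy : Measurable y) (i j : Fin n) :
    Measurable fun ω => arc a r (x ω) (y ω) i j := by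
  unfold arc sector
  refine measurable_const.and ?_
  have hxi : ∀ i, Measurable fun ω => x ω i := fun i => (measurable_pi_apply i).comp hx
  have hyi : ∀ i, Measurable fun ω => y ω i := fun i => (measurable_pi_apply i).comp hy
  simp only [mem_ofPred_eq]
  refine Measurable.and ?_ ?_
  · apply measurableSet_setOfPred.1
    exact measurableSet_le (((hxi j).sub (hxi i)).norm) measurable_const
  · apply measurableSet_setOfPred.1
    have := (isClosed_sec a).measurableSet
    exact (((hxi j).sub (hxi i)).prodMk (hyi i)) this

theorem measurable_isoT {Ω : Type*} [MeasurableSpace Ω] (a r : ℝ) {k : ℕ} (T : Fin k → Fin k → Prop)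
    {x : Ω → Fin k → ℂ}
    {y : Ω → Fin k → ℝ} (hx : Measurable x) (hy : Measurable y) :
    Measurable fun ω => isoT a r T (x ω) (y ω) := by
  unfold isoT
  refine Measurable.exists fun e => Measurable.forall fun i => Measurable.forall fun j => ?_
  exact measurable_const.iff (measurable_arc a r hx hy _ _)

theorem measurable_X {n : ℕ} : Measurable fun (w : Fin n → ℂ × ℝ) (i : Fin n) => (w i).1 := by
  fun_prop
theorem measurable_Y {n : ℕ} : Measurable fun (w : Fin n → ℂ × ℝ) (i : Fin n) => (w i).2 := by
  fun_prop

theorem measurable_indT (a r : ℝ) {k n : ℕ} (T : Fin k → Fin k → Prop) (s : Finset (Fin n)) :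
    Measurable fun w : Fin n → ℂ × ℝ => indT a r T w s := by
  unfold indT
  refine Measurable.exists fun g => measurable_const.and <|
    Measurable.forall fun i => Measurable.forall fun j => ?_
  exact measurable_const.iff (measurable_arc a r measurable_X measurable_Y _ _)

theorem measurable_isoS (a r : ℝ) {n : ℕ} (s : Finset (Fin n)) :
    Measurable fun w : Fin n → ℂ × ℝ => isoS a r w s := by
  unfold isoS
  refine Measurable.forall fun i => Measurable.forall fun _ => Measurable.forall fun j =>
    Measurable.forall fun _ => ?_
  exact (measurable_arc a r measurable_X measurable_Y _ _).not

theorem measurable_nb (ρ : ℝ) {n : ℕ} (i : Fin n) :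
    Measurable fun w : Fin n → ℂ × ℝ => (nb ρ w i).card := by
  classical
  unfold nb
  simp_rw [Finset.card_filter]
  refine Finset.measurable_sum _ fun j _ => ?_
  refine Measurable.ite ?_ measurable_const measurable_const
  exact measurableSet_le (by fun_prop) measurable_const

theorem measurable_Fam (a r : ℝ) {k n : ℕ} (T : Fin k → Fin k → Prop) (m : ℕ) :
    Measurable fun w : Fin n → ℂ × ℝ => ((Fam a r T m w).card : ℝ) := by
  classical
  refine (measurable_from_nat (f := fun n : ℕ => (n : ℝ))).comp ?_
  unfold Fam
  simp_rw [Finset.card_filter]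
  refine Finset.measurable_sum _ fun s _ => ?_
  refine Measurable.ite ?_ measurable_const measurable_const
  apply measurableSet_setOfPred.2
  refine (measurable_indT a r T s).and ((measurable_isoS a r s).and ?_)
  refine Measurable.forall fun i => Measurable.forall fun _ => ?_
  apply measurableSet_setOfPred.1
  exact measurableSet_le (measurable_nb _ i) measurable_const

theorem Fam_bdd (a r : ℝ) {k n : ℕ} (T : Fin k → Fin k → Prop) (m : ℕ) :
    ∃ B : ℝ, ∀ w : Fin n → ℂ × ℝ, |((Fam a r T m w).card : ℝ)| ≤ B := by
  classical
  refine ⟨(Finset.univ : Finset (Finset (Fin n))).card, fun w => ?_⟩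
  rw [abs_of_nonneg (Nat.cast_nonneg _)]
  exact_mod_cast Finset.card_le_univ _

/-- Concentration of the truncated count. -/
theorem Fam_conc (ν : Measure (ℂ × ℝ)) [IsProbabilityMeasure ν]
    {D : ℕ} (hD : ∀ (x : ℂ) (ρ : ℝ), 0 < ρ → ∃ t : Finset ℂ, t.card ≤ D ∧
    ∀ z, dist z x ≤ ρ → ∃ c ∈ t, dist z c ≤ ρ / 2)
    {a r : ℝ} (hr : 0 < r) {k : ℕ} (n : ℕ) (hk : 2 ≤ k) {T : Fin k → Fin k → Prop}
    (hT : (SimpleGraph.fromRel T).Connected) (m : ℕ) (s : ℝ) (hs : 0 ≤ s) :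
    (Measure.pi fun _ : Fin n => ν).real
      {w | s ≤ |((Fam a r T m w).card : ℝ) -
        ∫ w, ((Fam a r T m w).card : ℝ) ∂(Measure.pi fun _ : Fin n => ν)|} ≤
      2 * Real.exp (- s ^ 2 / (2 * (n * ((D * m + 1) * m ^ k) ^ 2))) := by
  have := mcd_tail ν (((D * m + 1) * m ^ k : ℕ) : NNReal) n
    (fun w => ((Fam a r T m w).card : ℝ)) (measurable_Fam a r T m) (Fam_bdd a r T m)
    (fun w i v => by simpa using Fam_diff hD hr hk hT m w i v) s hs
  simpa using this

/-- Cluster probability. -/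
theorem cluster (ν : Measure (ℂ × ℝ)) [IsProbabilityMeasure ν] (ρ : ℝ) (q : ENNReal)
    (hq : ∀ x, ν {p | dist p.1 x ≤ ρ} ≤ q) {n : ℕ} (i : Fin n) (t : Finset (Fin n)) (hi : i ∉ t) :
    (Measure.pi fun _ : Fin n => ν) {w | ∀ j ∈ t, dist (w j).1 (w i).1 ≤ ρ} ≤ q ^ t.card := by
  classical
  cases n with
  | zero => exact i.elim0
  | succ n =>
    have hmp := measurePreserving_piFinSuccAbove (fun _ : Fin (n+1) => ν) i
    set e := MeasurableEquiv.piFinSuccAbove (fun _ : Fin (n+1) => ℂ × ℝ) i with he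
    have hA : MeasurableSet {w : Fin (n+1) → ℂ × ℝ | ∀ j ∈ t, dist (w j).1 (w i).1 ≤ ρ} := by
      apply measurableSet_setOfPred.2
      refine Measurable.forall fun j => Measurable.forall fun _ => ?_
      apply measurableSet_setOfPred.1
      exact measurableSet_le (by fun_prop) measurable_const
    rw [← hmp.symm.measure_preimage hA.nullMeasurableSet, Measure.prod_apply (e.symm.measurable hA)]
    have hsec : ∀ p, (Measure.pi fun j : Fin n => ν) (Prod.mk p ⁻¹' (e.symm ⁻¹'
        {w : Fin (n+1) → ℂ × ℝ | ∀ j ∈ t, dist (w j).1 (w i).1 ≤ ρ})) ≤ q ^ t.card := by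
      intro p
      have hset : Prod.mk p ⁻¹' (e.symm ⁻¹'
        {w : Fin (n+1) → ℂ × ℝ | ∀ j ∈ t, dist (w j).1 (w i).1 ≤ ρ}) ⊆
        Set.pi univ (fun j : Fin n => if i.succAbove j ∈ t then {u : ℂ × ℝ | dist u.1 p.1 ≤ ρ} else univ) := by
        intro w hw j _
        simp only [mem_preimage, mem_ofPred_eq] at hw
        beta_reduce
        split_ifs with hj
        · have := hw _ hj
          have h1 : e.symm (p, w) (i.succAbove j) = w j :=
            Fin.insertNth_apply_succAbove (α := fun _ => ℂ × ℝ) i p w j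
          have h2 : e.symm (p, w) i = p := Fin.insertNth_apply_same (α := fun _ => ℂ × ℝ) i p w
          rw [h1, h2] at this
          exact this
        · trivial
      refine (measure_mono hset).trans ?_
      rw [Measure.pi_pi]
      have : ∀ j : Fin n, ν (if i.succAbove j ∈ t then {u : ℂ × ℝ | dist u.1 p.1 ≤ ρ} else univ)
          ≤ if i.succAbove j ∈ t then q else 1 := by
        intro j; split_ifs
        · exact hq _
        · simp
      refine (Finset.prod_le_prod' fun j _ => this j).trans ?_
      rw [Finset.prod_ite, Finset.prod_const, Finset.prod_const_one, mul_one]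
      apply le_of_eq
      congr 1
      have : t = (Finset.univ.filter fun j : Fin n => i.succAbove j ∈ t).map (Fin.succAboveEmb i) := by
        ext j
        simp only [Finset.mem_map, Finset.mem_filter, Finset.mem_univ, true_and, Fin.succAboveEmb_apply]
        constructor
        · intro hj
          obtain ⟨l, rfl⟩ := Fin.exists_succAbove_eq (show j ≠ i from fun h => hi (h ▸ hj))
          exact ⟨l, hj, rfl⟩
        · rintro ⟨l, hl, rfl⟩; exact hl
      conv_rhs => rw [this, Finset.card_map]
    refine (lintegral_mono hsec).trans ?_
    simp

theorem bad_le (ν : Measure (ℂ × ℝ)) [IsProbabilityMeasure ν] (ρ : ℝ) (q : ENNReal)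
    (hq : ∀ x, ν {p | dist p.1 x ≤ ρ} ≤ q) (n m : ℕ) :
    (Measure.pi fun _ : Fin n => ν) {w | ∃ i, m < (nb ρ w i).card} ≤ n * (n * q) ^ m := by
  classical
  have hsub : {w : Fin n → ℂ × ℝ | ∃ i, m < (nb ρ w i).card} ⊆
      ⋃ i ∈ (Finset.univ : Finset (Fin n)), ⋃ t ∈ Finset.powersetCard m (Finset.univ.erase i),
        {w | ∀ j ∈ t, dist (w j).1 (w i).1 ≤ ρ} := by
    rintro w ⟨i, hi⟩
    have : m ≤ ((nb ρ w i).erase i).card := by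
      have := Finset.pred_card_le_card_erase (s := nb ρ w i) (a := i)
      omega
    obtain ⟨t, ht, htc⟩ := Finset.exists_subset_card_eq this
    simp only [mem_iUnion]
    refine ⟨i, Finset.mem_univ _, t, ?_, ?_⟩
    · rw [Finset.mem_powersetCard]
      exact ⟨ht.trans (Finset.erase_subset_erase _ (Finset.subset_univ _)), htc⟩
    · intro j hj
      have := Finset.mem_of_mem_erase (ht hj)
      exact (Finset.mem_filter.1 this).2
  refine (measure_mono hsub).trans ((measure_biUnion_finset_le _ _).trans ?_)
  have h1 : ∀ i : Fin n, (Measure.pi fun _ : Fin n => ν)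
      (⋃ t ∈ Finset.powersetCard m (Finset.univ.erase i),
        {w | ∀ j ∈ t, dist (w j).1 (w i).1 ≤ ρ}) ≤ (n * q) ^ m := by
    intro i
    refine (measure_biUnion_finset_le _ _).trans ?_
    have h2 : ∀ t ∈ Finset.powersetCard m (Finset.univ.erase i),
        (Measure.pi fun _ : Fin n => ν) {w | ∀ j ∈ t, dist (w j).1 (w i).1 ≤ ρ} ≤ q ^ m := by
      intro t ht
      rw [Finset.mem_powersetCard] at ht
      have := cluster ν ρ q hq i t (fun h => by simpa using ht.1 h)
      rwa [ht.2] at this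
    refine (Finset.sum_le_sum h2).trans ?_
    rw [Finset.sum_const, Finset.card_powersetCard, nsmul_eq_mul, mul_pow]
    gcongr
    rw [← Nat.cast_pow, Nat.cast_le]
    refine (Nat.choose_le_pow _ _).trans (Nat.pow_le_pow_left ?_ _)
    simpa using Finset.card_le_univ (Finset.univ.erase i)
  refine (Finset.sum_le_sum fun i _ => h1 i).trans ?_
  simp

theorem pi_marg (ν : Measure (ℂ × ℝ)) [IsProbabilityMeasure ν] {k n : ℕ} (g : Fin k ↪ Fin n) :
    (Measure.pi fun _ : Fin n => ν).map (fun w i => w (g i)) = Measure.pi fun _ : Fin k => ν := by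
  have h := iIndepFun_pi (μ := fun _ : Fin n => ν) (X := fun _ p => p) (fun i => aemeasurable_id)
  have h2 := h.precomp g.injective
  rw [iIndepFun_iff_map_fun_eq_pi_map (fun i => (measurable_pi_apply (g i)).aemeasurable)] at h2
  rw [h2]
  congr 1
  funext i
  exact (measurePreserving_eval (fun _ : Fin n => ν) (g i)).map_eq

theorem indT_iff_isoT (a r : ℝ) {k n : ℕ} (T : Fin k → Fin k → Prop) (g : Fin k ↪ Fin n)
    (w : Fin n → ℂ × ℝ) : indT a r T w (Finset.univ.map g) ↔
      isoT a r T (fun i => (w (g i)).1) (fun i => (w (g i)).2) := by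
  classical
  unfold indT isoT
  have harc : ∀ i j, arc a r (fun i => (w i).1) (fun i => (w i).2) (g i) (g j) ↔
      arc a r (fun i => (w (g i)).1) (fun i => (w (g i)).2) i j := by
    intro i j; unfold arc; simp
  constructor
  · rintro ⟨g', hg', h⟩
    have hex : ∀ i, ∃ j, g j = g' i := by
      intro i
      have : g' i ∈ Finset.univ.map g := by rw [← hg']; simp
      simpa using this
    choose e he using hex
    have hinj : Function.Injective e := by
      intro i j hij
      apply g'.injective
      rw [← he, ← he, hij]
    refine ⟨Equiv.ofBijective e (Finite.injective_iff_bijective.1 hinj), fun i j => ?_⟩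
    rw [h, ← he, ← he, harc]; rfl
  · rintro ⟨e, he⟩
    refine ⟨e.toEmbedding.trans g, ?_, fun i j => ?_⟩
    · rw [← Finset.map_map]; simp
    · rw [he, ← harc]; rfl

theorem indT_prob (ν : Measure (ℂ × ℝ)) [IsProbabilityMeasure ν] (a r : ℝ) {k n : ℕ}
    (T : Fin k → Fin k → Prop) (s : Finset (Fin n)) (hs : s.card = k) :
    (Measure.pi fun _ : Fin n => ν).real {w | indT a r T w s} =
    (Measure.pi fun _ : Fin k => ν).real {w | isoT a r T (fun i => (w i).1) (fun i => (w i).2)} := by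
  set g := (s.orderEmbOfFin hs).toEmbedding with hg
  have hgs : Finset.univ.map g = s := by
    simp [hg]
  have hset : {w | indT a r T w s} = (fun (w : Fin n → ℂ × ℝ) i => w (g i)) ⁻¹'
      {w | isoT a r T (fun i => (w i).1) (fun i => (w i).2)} := by
    ext w
    conv_lhs => rw [← hgs]
    exact indT_iff_isoT a r T g w
  have hm : MeasurableSet {w : Fin k → ℂ × ℝ | isoT a r T (fun i => (w i).1) (fun i => (w i).2)} :=
    measurableSet_setOfPred.2 (measurable_isoT a r T measurable_X measurable_Y)
  rw [hset, ← pi_marg ν g, map_measureReal_apply (by fun_prop) hm]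

theorem mean_est (ν : Measure (ℂ × ℝ)) [IsProbabilityMeasure ν] {a r : ℝ} (hr : 0 < r) {k : ℕ} (n m : ℕ)
    (hk : 2 ≤ k) {T : Fin k → Fin k → Prop} (hT : (SimpleGraph.fromRel T).Connected)
    (q : ℝ) (hq0 : 0 ≤ q) (hq : ∀ x, ν {p | dist p.1 x ≤ (k + 1) * r} ≤ ENNReal.ofReal q) :
    |∫ w, ((Fam a r T m w).card : ℝ) ∂(Measure.pi fun _ : Fin n => ν) - (n.choose k) *
      (Measure.pi fun _ : Fin k => ν).real {w | isoT a r T (fun i => (w i).1) (fun i => (w i).2)}|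
      ≤ (n:ℝ) ^ k * (n * q ^ k + n * (n * q) ^ m) := by
  classical
  set P := (Measure.pi fun _ : Fin n => ν) with hP
  set p := (Measure.pi fun _ : Fin k => ν).real
    {w | isoT a r T (fun i => (w i).1) (fun i => (w i).2)} with hp
  have hmeas : ∀ s : Finset (Fin n), MeasurableSet {w : Fin n → ℂ × ℝ | s ∈ Fam a r T m w} := by
    intro s
    simp only [Fam, Finset.mem_filter, Finset.mem_univ, true_and]
    apply measurableSet_setOfPred.2
    refine (measurable_indT a r T s).and ((measurable_isoS a r s).and ?_)
    refine Measurable.forall fun i => Measurable.forall fun _ => ?_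
    apply measurableSet_setOfPred.1
    exact measurableSet_le (measurable_nb _ i) measurable_const
  have hInte : ∫ w, ((Fam a r T m w).card : ℝ) ∂P =
      ∑ s ∈ Finset.powersetCard k (Finset.univ : Finset (Fin n)), P.real {w | s ∈ Fam a r T m w} := by
    have h1 : ∀ w : Fin n → ℂ × ℝ, ((Fam a r T m w).card : ℝ) =
        ∑ s ∈ Finset.powersetCard k (Finset.univ : Finset (Fin n)),
          ({w | s ∈ Fam a r T m w}.indicator (fun _ => (1:ℝ)) w) := by
      intro w
      have : Fam a r T m w = (Finset.powersetCard k (Finset.univ : Finset (Fin n))).filter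
          (fun s => s ∈ Fam a r T m w) := by
        ext s
        rw [Finset.mem_filter, Finset.mem_powersetCard]
        refine ⟨fun h => ⟨⟨Finset.subset_univ _, ?_⟩, h⟩, fun h => h.2⟩
        exact indT_card (Finset.mem_filter.1 h).2.1
      conv_lhs => rw [this, Finset.card_filter]
      push_cast
      refine Finset.sum_congr rfl fun s _ => ?_
      simp [Set.indicator_apply]
    simp_rw [h1]
    rw [integral_finsetSum]
    · refine Finset.sum_congr rfl fun s _ => ?_
      rw [integral_indicator_const _ (hmeas s)]; simp
    · intro s _
      exact (integrable_const _).indicator (hmeas s)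
  have hup : ∀ s ∈ Finset.powersetCard k (Finset.univ : Finset (Fin n)),
      P.real {w | s ∈ Fam a r T m w} ≤ p := by
    intro s hs
    rw [hp, ← indT_prob ν a r T s (Finset.mem_powersetCard.1 hs).2]
    exact measureReal_mono (fun w (hw : s ∈ Fam a r T m w) => by
      simp only [Fam, Finset.mem_filter] at hw
      exact hw.2.1)
  have hbad : P.real {w | ∃ i, m < (nb ((k + 1) * r) w i).card} ≤ n * (n * q) ^ m := by
    refine ENNReal.toReal_le_of_le_ofReal (by positivity) ((bad_le ν _ _ hq n m).trans (le_of_eq ?_))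
    rw [ENNReal.ofReal_mul (by positivity), ENNReal.ofReal_pow (by positivity),
      ENNReal.ofReal_mul (by positivity), ENNReal.ofReal_natCast]
  have hlow : ∀ s ∈ Finset.powersetCard k (Finset.univ : Finset (Fin n)),
      p ≤ P.real {w | s ∈ Fam a r T m w} + (n * q ^ k + n * (n * q) ^ m) := by
    intro s hs
    have hsc := (Finset.mem_powersetCard.1 hs).2
    obtain ⟨s0, hs0⟩ : s.Nonempty := by rw [← Finset.card_pos]; omega
    rw [hp, ← indT_prob ν a r T s hsc]
    have hsub : {w | indT a r T w s} ⊆ {w | s ∈ Fam a r T m w} ∪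
        ((⋃ j ∈ (Finset.univ.filter fun j : Fin n => j ∉ s),
          {w | ∀ l ∈ insert j (s.erase s0), dist (w l).1 (w s0).1 ≤ (k + 1) * r}) ∪
          {w | ∃ i, m < (nb ((k + 1) * r) w i).card}) := by
      intro w hw
      by_contra hcon
      rw [mem_union, mem_union] at hcon
      push Not at hcon
      obtain ⟨h1, h2, h3⟩ := hcon
      simp only [mem_ofPred_eq] at h3
      push Not at h3
      apply h1
      simp only [mem_ofPred_eq, Fam, Finset.mem_filter, Finset.mem_univ, true_and]
      refine ⟨hw, ?_, fun i _ => h3 i⟩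
      intro i hi j hj harc
      apply h2
      simp only [mem_iUnion]
      refine ⟨j, by simpa using hj, ?_⟩
      have hd : ∀ l ∈ s, dist (w l).1 (w s0).1 ≤ k * r := fun l hl => indT_dist hr.le hT hw hl hs0
      intro l hl
      rcases Finset.mem_insert.1 hl with rfl | hl
      · have h4 : dist (w l).1 (w i).1 ≤ r := arc_dist harc
        have h5 := dist_triangle (w l).1 (w i).1 (w s0).1
        have h6 := hd i hi
        linarith
      · have := hd l (Finset.mem_of_mem_erase hl)
        linarith
    refine (measureReal_mono hsub).trans ((measureReal_union_le _ _).trans ?_)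
    gcongr
    refine (measureReal_union_le _ _).trans (add_le_add ?_ hbad)
    refine (measureReal_biUnion_finset_le _ _).trans ?_
    have : ∀ j ∈ (Finset.univ.filter fun j : Fin n => j ∉ s),
        P.real {w | ∀ l ∈ insert j (s.erase s0), dist (w l).1 (w s0).1 ≤ (k + 1) * r} ≤ q ^ k := by
      intro j hj
      have hj : j ∉ s := by simpa using hj
      refine ENNReal.toReal_le_of_le_ofReal (by positivity) ((cluster ν _ _ hq s0 _ ?_).trans (le_of_eq ?_))
      · simp only [Finset.mem_insert, Finset.mem_erase, not_or]
        exact ⟨fun h => hj (h ▸ hs0), fun h => h.1 rfl⟩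
      · rw [ENNReal.ofReal_pow hq0, Finset.card_insert_of_notMem (fun h => hj (Finset.mem_of_mem_erase h)),
          Finset.card_erase_of_mem hs0, hsc]
        congr 1; omega
    refine (Finset.sum_le_sum this).trans ?_
    rw [Finset.sum_const, nsmul_eq_mul]
    gcongr
    simpa using Finset.card_le_univ (Finset.univ.filter fun j : Fin n => j ∉ s)
  have hcard : (Finset.powersetCard k (Finset.univ : Finset (Fin n))).card = n.choose k := by simp
  have hU := Finset.sum_le_sum hup
  have hL := Finset.sum_le_sum hlow
  rw [Finset.sum_add_distrib] at hL
  rw [Finset.sum_const, hcard, nsmul_eq_mul] at hU hL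
  rw [Finset.sum_const, hcard, nsmul_eq_mul] at hL
  rw [hInte]
  have hch : (n.choose k : ℝ) ≤ (n:ℝ) ^ k := by exact_mod_cast Nat.choose_le_pow n k
  have hX : 0 ≤ (n * q ^ k + n * (n * q) ^ m : ℝ) := by positivity
  have := mul_le_mul_of_nonneg_right hch hX
  rw [abs_le]
  constructor <;> linarith

section

open scoped ENNReal

theorem measurable_cons {E : Type*} [MeasurableSpace E] {n : ℕ} :
    Measurable fun p : E × (Fin n → E) => (Fin.cons p.1 p.2 : Fin (n+1) → E) := by
  refine measurable_pi_lambda _ fun i => ?_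
  refine Fin.cases ?_ (fun j => ?_) i
  · simpa using measurable_fst
  · simp only [Fin.cons_succ]; fun_prop

theorem lint_cons {E : Type*} [MeasurableSpace E] (μ : Measure E) [SigmaFinite μ] {n : ℕ}
    (H : (Fin (n+1) → E) → ℝ≥0∞) (hH : Measurable H) :
    ∫⁻ w, H w ∂(Measure.pi fun _ : Fin (n+1) => μ) =
      ∫⁻ x, ∫⁻ w, H (Fin.cons x w) ∂(Measure.pi fun _ : Fin n => μ) ∂μ := by
  set e := MeasurableEquiv.piFinSuccAbove (fun _ : Fin (n+1) => E) 0 with he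
  have hmp : MeasurePreserving e (Measure.pi fun _ : Fin (n+1) => μ)
      (μ.prod (Measure.pi fun _ : Fin n => μ)) :=
    measurePreserving_piFinSuccAbove (fun _ : Fin (n+1) => μ) 0
  have hes : ∀ p : E × (Fin n → E), e.symm p = Fin.cons p.1 p.2 := by
    intro p; simp [he, MeasurableEquiv.piFinSuccAbove]
    rfl
  rw [← hmp.symm.lintegral_comp hH]
  simp_rw [hes]
  exact lintegral_prod _ (hH.comp measurable_cons).aemeasurable

theorem lint_density {E : Type*} [MeasurableSpace E] (μ : Measure E) [SigmaFinite μ]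
    (φ : E → ℝ≥0∞) (hφ : Measurable φ) [SigmaFinite (μ.withDensity φ)] :
    ∀ (n : ℕ) (H : (Fin n → E) → ℝ≥0∞), Measurable H →
    ∫⁻ w, H w ∂(Measure.pi fun _ : Fin n => μ.withDensity φ) =
      ∫⁻ w, (∏ i, φ (w i)) * H w ∂(Measure.pi fun _ : Fin n => μ) := by
  intro n
  induction n with
  | zero => intro H hH; simp [lintegral_unique]
  | succ n ih =>
    intro H hH
    have hP : Measurable fun w : Fin (n+1) → E => ∏ i, φ (w i) :=
      Finset.measurable_prod _ fun i _ => hφ.comp (measurable_pi_apply i)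
    rw [lint_cons _ _ hH, lint_cons _ (fun w => (∏ i, φ (w i)) * H w) (hP.mul hH)]
    have hc : ∀ x : E, Measurable fun w : Fin n → E => (Fin.cons x w : Fin (n+1) → E) :=
      fun x => measurable_cons.comp (measurable_const.prodMk measurable_id)
    have h1 : ∀ x, ∫⁻ w, H (Fin.cons x w) ∂(Measure.pi fun _ : Fin n => μ.withDensity φ) =
      ∫⁻ w, (∏ i, φ (w i)) * H (Fin.cons x w) ∂(Measure.pi fun _ : Fin n => μ) :=
      fun x => ih (fun w => H (Fin.cons x w)) (hH.comp (hc x))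
    simp_rw [h1]
    have hP' : Measurable fun w : Fin n → E => ∏ i, φ (w i) :=
      Finset.measurable_prod _ fun i _ => hφ.comp (measurable_pi_apply i)
    rw [lintegral_withDensity_eq_lintegral_mul _ hφ]
    · refine lintegral_congr fun x => ?_
      simp only [Pi.mul_apply]
      rw [← lintegral_const_mul (φ x) (f := fun w => (∏ i, φ (w i)) * H (Fin.cons x w)) (hP'.mul (hH.comp (hc x)))]
      refine lintegral_congr fun w => ?_
      rw [Fin.prod_univ_succ]; simp [mul_assoc]
    · exact Measurable.lintegral_prod_right ((hP'.comp measurable_snd).mul (hH.comp measurable_cons))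

theorem lint_scale {k : ℕ} (x : ℂ) {r : ℝ} (hr : 0 < r) (H : (Fin k → ℂ) → ℝ≥0∞) (hH : Measurable H) :
    ∫⁻ w, H w = ENNReal.ofReal (r ^ (2 * k)) * ∫⁻ z : Fin k → ℂ, H (fun i => x + r * z i) := by
  have h1 : ∫⁻ w, H w = ∫⁻ w : Fin k → ℂ, H ((fun _ => x) + w) := by
    rw [lintegral_add_left_eq_self]
  have h2 := Measure.map_addHaar_smul (volume : Measure (Fin k → ℂ)) hr.ne'
  have hfr : Module.finrank ℝ (Fin k → ℂ) = 2 * k := by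
    rw [Module.finrank_pi_fintype]; simp [Complex.finrank_real_complex, mul_comm]
  rw [hfr] at h2
  set H' : (Fin k → ℂ) → ℝ≥0∞ := fun w => H ((fun _ => x) + w) with hH'
  have hH'm : Measurable H' := hH.comp (measurable_const_add _)
  have h3 : ∫⁻ z : Fin k → ℂ, H (fun i => x + r * z i) = ∫⁻ z, H' (r • z) := by
    refine lintegral_congr fun z => ?_
    simp only [hH']
    congr 1
  have h4 : ∫⁻ z, H' (r • z) = ∫⁻ w, H' w ∂(Measure.map (fun z : Fin k → ℂ => r • z) volume) := by
    rw [lintegral_map hH'm (measurable_const_smul r)]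
  rw [h1, h3, h4]
  have h5 : Measure.map (fun z : Fin k → ℂ => r • z) volume = Measure.map (r • ·) volume := rfl
  rw [h5, h2, lintegral_smul_measure, smul_eq_mul, ← mul_assoc, ← ENNReal.ofReal_mul (by positivity),
    abs_of_pos (by positivity), mul_inv_cancel₀ (by positivity), ENNReal.ofReal_one, one_mul]

theorem isoT_scale (a : ℝ) {r : ℝ} (hr : 0 < r) {k : ℕ} (T : Fin k → Fin k → Prop) (c : ℂ)
    (x : Fin k → ℂ) (y : Fin k → ℝ) :
    isoT a r T (fun i => c + r * x i) y ↔ isoT a 1 T x y := by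
  have : ∀ i j, arc a r (fun i => c + r * x i) y i j ↔ arc a 1 x y i j := by
    intro i j
    unfold arc sector
    simp only [mem_ofPred_eq]
    have h1 : c + r * x j - (c + r * x i) = r * (x j - x i) := by ring
    have h2 : ‖c + r * x j - (c + r * x i)‖ = r * ‖x j - x i‖ := by
      rw [h1, norm_mul, Complex.norm_real, Real.norm_eq_abs, abs_of_pos hr]
    have hrc : (r : ℂ) ≠ 0 := by exact_mod_cast hr.ne'
    rw [h2, h1]
    refine and_congr_right fun _ => and_congr ?_ (exists_congr fun t => and_congr_right fun _ =>
      and_congr_right fun _ => ?_)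
    · constructor <;> intro h <;> nlinarith
    · push_cast
      rw [mul_assoc, mul_right_inj' hrc]
  unfold isoT
  simp_rw [this]

theorem pts_eq {k : ℕ} (z : Fin k → ℂ) : (pts (k := k+1) z) = (Fin.cons 0 z : Fin (k+1) → ℂ) := by
  funext i
  refine Fin.cases ?_ (fun j => ?_) i
  · simp [pts]
  · simp [pts]

/-- Configurations around the origin inducing `T`. -/
def Wset (a : ℝ) {k : ℕ} (T : Fin (k+1) → Fin (k+1) → Prop) : Set ((Fin (k+1) → ℝ) × (Fin k → ℂ)) :=
  {p | isoT a 1 T (pts (k := k+1) p.2) p.1}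

/-- inner density integral -/
def Gint (φ : ℂ → ℝ≥0∞) {k : ℕ} (r : ℝ) (z : Fin k → ℂ) : ℝ≥0∞ :=
  ∫⁻ x, φ x * ∏ i, φ (x + r * z i)

theorem measurable_pts {k : ℕ} : Measurable fun z : Fin k → ℂ => pts (k := k+1) z := by
  have : (fun z : Fin k → ℂ => pts (k := k+1) z) = fun z => (Fin.cons 0 z : Fin (k+1) → ℂ) := by
    funext z; exact pts_eq z
  rw [this]
  exact measurable_cons.comp (measurable_const.prodMk measurable_id)

theorem measurableSet_W (a : ℝ) {k : ℕ} (T : Fin (k+1) → Fin (k+1) → Prop) :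
    MeasurableSet (Wset a T) :=
  measurableSet_setOfPred.2 (measurable_isoT a 1 T (measurable_pts.comp measurable_snd) measurable_fst)

theorem W_sub (a : ℝ) {k : ℕ} {T : Fin (k+1) → Fin (k+1) → Prop}
    (hT : (SimpleGraph.fromRel T).Connected) :
    Wset a T ⊆ univ ×ˢ Metric.closedBall 0 ((k:ℝ) + 1) := by
  rintro ⟨y, z⟩ ⟨e, he⟩
  refine ⟨trivial, ?_⟩
  simp only [mem_closedBall_zero_iff]
  rw [pi_norm_le_iff_of_nonneg (by positivity)]
  intro i
  have := conn_dist (a := a) zero_le_one hT (pts (k := k+1) z) y e he (e.symm i.succ) (e.symm 0)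
  simp only [Equiv.apply_symm_apply, pts_eq, Fin.cons_succ, Fin.cons_zero, dist_zero_right] at this
  push_cast at this
  linarith

theorem pn_formula (φ : ℂ → ℝ≥0∞) (hφ : Measurable φ) [IsProbabilityMeasure (volume.withDensity φ)]
    (U : Measure ℝ) [IsProbabilityMeasure U] (a : ℝ) {r : ℝ} (hr : 0 < r) {k : ℕ}
    (T : Fin (k+1) → Fin (k+1) → Prop) :
    (Measure.pi fun _ : Fin (k+1) => (volume.withDensity φ).prod U)
      {w | isoT a r T (fun i => (w i).1) (fun i => (w i).2)} =
    ENNReal.ofReal (r ^ (2 * k)) *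
      ∫⁻ p, (Wset a T).indicator 1 p * Gint φ r p.2 ∂((Measure.pi fun _ : Fin (k+1) => U).prod volume) := by
  classical
  set B : Set ((Fin (k+1) → ℂ) × (Fin (k+1) → ℝ)) := {p | isoT a r T p.1 p.2} with hB
  have hBm : MeasurableSet B := measurableSet_setOfPred.2 (measurable_isoT a r T measurable_fst measurable_snd)
  have hmp := measurePreserving_arrowProdEquivProdArrow ℂ ℝ (Fin (k+1))
    (fun _ => volume.withDensity φ) (fun _ => U)
  have h1 : {w : Fin (k+1) → ℂ × ℝ | isoT a r T (fun i => (w i).1) (fun i => (w i).2)} =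
    (MeasurableEquiv.arrowProdEquivProdArrow ℂ ℝ (Fin (k+1))) ⁻¹' B := rfl
  rw [h1, hmp.measure_preimage hBm.nullMeasurableSet, Measure.prod_apply_symm hBm]
  have hGm : Measurable fun q : (Fin k → ℂ) × ℂ => φ q.2 * ∏ i, φ (q.2 + r * q.1 i) := by
    refine (hφ.comp measurable_snd).mul (Finset.measurable_prod _ fun i _ => hφ.comp ?_)
    fun_prop
  have hGm' : Measurable fun z : Fin k → ℂ => Gint φ r z := hGm.lintegral_prod_right
  rw [lintegral_prod]
  swap
  · exact ((measurable_one.indicator (measurableSet_W a T)).mul (hGm'.comp measurable_snd)).aemeasurable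
  have hin : ∀ y, (Measure.pi fun _ : Fin (k+1) => volume.withDensity φ) ((fun x => (x, y)) ⁻¹' B) =
      ENNReal.ofReal (r ^ (2 * k)) * ∫⁻ z, (Wset a T).indicator 1 (y, z) * Gint φ r z := by
    intro y
    have hm : MeasurableSet ((fun x => (x, y)) ⁻¹' B) := (measurable_id.prodMk measurable_const) hBm
    set H : (Fin (k+1) → ℂ) → ℝ≥0∞ := ((fun x => (x, y)) ⁻¹' B).indicator 1 with hH
    have hHm : Measurable H := measurable_one.indicator hm
    have hP : Measurable fun w : Fin (k+1) → ℂ => (∏ i, φ (w i)) * H w :=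
      (Finset.measurable_prod _ fun i _ => hφ.comp (measurable_pi_apply i)).mul hHm
    rw [← lintegral_indicator_one hm, lint_density volume φ hφ (k+1) H hHm, lint_cons volume _ hP]
    have hc : ∀ x : ℂ, Measurable fun w : Fin k → ℂ => (Fin.cons x w : Fin (k+1) → ℂ) :=
      fun x => measurable_cons.comp (measurable_const.prodMk measurable_id)
    have h2 : ∀ x : ℂ, ∫⁻ w, (∏ i, φ ((Fin.cons x w : Fin (k+1) → ℂ) i)) * H (Fin.cons x w)
        ∂(Measure.pi fun _ : Fin k => volume) =
        ENNReal.ofReal (r ^ (2 * k)) * ∫⁻ z : Fin k → ℂ,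
          (Wset a T).indicator 1 (y, z) * (φ x * ∏ i, φ (x + r * z i)) := by
      intro x
      rw [← volume_pi, lint_scale x hr (fun w => (∏ i, φ ((Fin.cons x w : Fin (k+1) → ℂ) i)) * H (Fin.cons x w))
        (hP.comp (hc x))]
      congr 1
      refine lintegral_congr fun z => ?_
      rw [Fin.prod_univ_succ, mul_comm]
      simp only [Fin.cons_zero, Fin.cons_succ]
      congr 1
      have h3 : (Fin.cons x (fun i => x + r * z i) : Fin (k+1) → ℂ) =
          fun i => x + r * (Fin.cons 0 z : Fin (k+1) → ℂ) i := by
        funext i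
        refine Fin.cases ?_ (fun j => ?_) i <;> simp
      have h4 := isoT_scale a hr T x (Fin.cons 0 z : Fin (k+1) → ℂ) y
      simp only [hH, indicator_apply, mem_preimage, hB, Wset, mem_ofPred_eq, h3, pts_eq, h4, Pi.one_apply]
    simp_rw [h2]
    have hm2 : Measurable (fun q : ℂ × (Fin k → ℂ) =>
          (Wset a T).indicator (1 : (Fin (k+1) → ℝ) × (Fin k → ℂ) → ℝ≥0∞) (y, q.2) * (φ q.1 * ∏ i, φ (q.1 + r * q.2 i))) := by
      refine Measurable.mul ?_ (hGm.comp measurable_swap)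
      exact (measurable_one.indicator (measurableSet_W a T)).comp
        (measurable_const.prodMk measurable_snd)
    rw [lintegral_const_mul _ hm2.lintegral_prod_right, lintegral_lintegral_swap hm2.aemeasurable]
    congr 1
    refine lintegral_congr fun z => ?_
    rw [lintegral_const_mul]
    · rfl
    · exact hGm.comp (measurable_const.prodMk measurable_id)
  simp_rw [hin]
  rw [lintegral_const_mul]
  have : Measurable (fun p : (Fin (k+1) → ℝ) × (Fin k → ℂ) =>
      (Wset a T).indicator (1 : (Fin (k+1) → ℝ) × (Fin k → ℂ) → ℝ≥0∞) p * Gint φ r p.2) :=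
    (measurable_one.indicator (measurableSet_W a T)).mul (hGm'.comp measurable_snd)
  exact this.lintegral_prod_right

theorem ae_measurable_of_ae_cont {f : ℂ → ℝ} (hfc : ∀ᵐ x : ℂ, ContinuousAt f x) :
    AEMeasurable f (volume : Measure ℂ) := by
  have hG : IsGδ {x | ContinuousAt f x} := IsGδ.setOfPred_continuousAt f
  have hm : MeasurableSet {x | ContinuousAt f x} := hG.measurableSet
  have h1 : AEMeasurable f (volume.restrict {x | ContinuousAt f x}) :=
    ContinuousOn.aemeasurable (fun x hx => ContinuousAt.continuousWithinAt hx) hm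
  have h2 : (volume : Measure ℂ).restrict {x | ContinuousAt f x} = volume :=
    Measure.restrict_eq_self_of_ae_mem hfc
  rwa [h2] at h1

/-- a.e. shifted convergence -/
theorem ae_shift {f g : ℂ → ℝ} (hfc : ∀ᵐ x : ℂ, ContinuousAt f x) (hfg : f =ᵐ[volume] g)
    (r : ℕ → ℝ) (hr : Tendsto r atTop (𝓝 0)) (z : ℂ) :
    ∀ᵐ x : ℂ, Tendsto (fun n => g (x + r n * z)) atTop (𝓝 (g x)) := by
  have h1 : ∀ᵐ x : ℂ, ∀ n, f (x + r n * z) = g (x + r n * z) := by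
    rw [ae_all_iff]
    intro n
    exact (measurePreserving_add_right (volume : Measure ℂ) ((r n : ℂ) * z)).quasiMeasurePreserving.ae hfg
  filter_upwards [h1, hfc, hfg] with x h1 h2 h3
  rw [← h3]
  refine Tendsto.congr h1 ?_
  have h4 : Tendsto (fun n => x + (r n : ℂ) * z) atTop (𝓝 x) := by
    have : Tendsto (fun n => x + ((r n : ℝ) : ℂ) * z) atTop (𝓝 (x + ((0:ℝ):ℂ) * z)) :=
      tendsto_const_nhds.add (((Complex.continuous_ofReal.tendsto 0).comp hr).mul_const z)
    simpa using this
  exact h2.tendsto.comp h4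

theorem Gint_le {φ : ℂ → ℝ≥0∞} {C : ℝ≥0∞} (hC : ∀ x, φ x ≤ C) (hφ : Measurable φ) (h1 : ∫⁻ x, φ x = 1) {k : ℕ}
    (r : ℝ) (z : Fin k → ℂ) : Gint φ r z ≤ C ^ k := by
  unfold Gint
  calc _ ≤ ∫⁻ x, φ x * C ^ k := by
        refine lintegral_mono fun x => ?_
        gcongr
        calc _ ≤ ∏ i : Fin k, C := Finset.prod_le_prod' fun i _ => hC _
          _ = _ := by simp
    _ = C ^ k := by rw [lintegral_mul_const _ hφ, h1, one_mul]

theorem Gint_tendsto {f g : ℂ → ℝ} (hfc : ∀ᵐ x : ℂ, ContinuousAt f x) (hfg : f =ᵐ[volume] g)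
    (hg : Measurable g) {C : ℝ≥0∞} (hCt : C ≠ ⊤) (hC : ∀ x, ENNReal.ofReal (g x) ≤ C)
    (h1 : ∫⁻ x, ENNReal.ofReal (g x) = 1)
    (r : ℕ → ℝ) (hr : Tendsto r atTop (𝓝 0)) {k : ℕ} (z : Fin k → ℂ) :
    Tendsto (fun n => Gint (fun x => ENNReal.ofReal (g x)) (r n) z) atTop
      (𝓝 (∫⁻ x, ENNReal.ofReal (g x) ^ (k+1))) := by
  unfold Gint
  have hφ : Measurable fun x => ENNReal.ofReal (g x) := hg.ennreal_ofReal
  refine tendsto_lintegral_of_dominated_convergence (fun x => ENNReal.ofReal (g x) * C ^ k) ?_ ?_ ?_ ?_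
  · intro n
    refine hφ.mul (Finset.measurable_prod _ fun i _ => hφ.comp ?_)
    fun_prop
  · intro n
    refine ae_of_all _ fun x => ?_
    refine mul_le_mul_right ?_ _
    calc _ ≤ ∏ i : Fin k, C := Finset.prod_le_prod' fun i _ => hC _
      _ = _ := by simp
  · rw [lintegral_mul_const _ hφ, h1, one_mul]
    exact ENNReal.pow_ne_top hCt
  · have : ∀ᵐ x : ℂ, ∀ i, Tendsto (fun n => g (x + r n * z i)) atTop (𝓝 (g x)) := by
      rw [ae_all_iff]; exact fun i => ae_shift hfc hfg r hr (z i)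
    filter_upwards [this] with x hx
    have h2 : ENNReal.ofReal (g x) ^ (k+1) = ENNReal.ofReal (g x) * ∏ i : Fin k, ENNReal.ofReal (g x) := by
      simp [pow_succ, mul_comm]
    rw [h2]
    refine ENNReal.Tendsto.const_mul ?_ (Or.inr ENNReal.ofReal_ne_top)
    exact ENNReal.tendsto_finsetProd_of_ne_top _
      (fun i _ => (ENNReal.continuous_ofReal.tendsto _).comp (hx i)) (fun i _ => ENNReal.ofReal_ne_top)

theorem int_tendsto {f g : ℂ → ℝ} (hfc : ∀ᵐ x : ℂ, ContinuousAt f x) (hfg : f =ᵐ[volume] g)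
    (hg : Measurable g) {C : ℝ≥0∞} (hCt : C ≠ ⊤) (hC : ∀ x, ENNReal.ofReal (g x) ≤ C)
    (h1 : ∫⁻ x, ENNReal.ofReal (g x) = 1)
    (r : ℕ → ℝ) (hr : Tendsto r atTop (𝓝 0)) (a : ℝ) {k : ℕ} {T : Fin (k+1) → Fin (k+1) → Prop}
    (hT : (SimpleGraph.fromRel T).Connected)
    (U : Measure ℝ) [IsProbabilityMeasure U] :
    Tendsto (fun n => ∫⁻ p, (Wset a T).indicator 1 p * Gint (fun x => ENNReal.ofReal (g x)) (r n) p.2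
      ∂((Measure.pi fun _ : Fin (k+1) => U).prod volume)) atTop
      (𝓝 (((Measure.pi fun _ : Fin (k+1) => U).prod volume) (Wset a T) *
        ∫⁻ x, ENNReal.ofReal (g x) ^ (k+1))) := by
  have hφ : Measurable fun x => ENNReal.ofReal (g x) := hg.ennreal_ofReal
  have hWm := measurableSet_W a T
  rw [← lintegral_indicator_one hWm, ← lintegral_mul_const _ (measurable_one.indicator hWm)]
  refine tendsto_lintegral_of_dominated_convergence
    (fun p => (univ ×ˢ Metric.closedBall 0 ((k:ℝ)+1)).indicator (fun _ => C ^ k) p) ?_ ?_ ?_ ?_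
  · intro n
    refine (measurable_one.indicator hWm).mul ?_
    have hGm : Measurable fun q : (Fin k → ℂ) × ℂ => ENNReal.ofReal (g q.2) * ∏ i, ENNReal.ofReal (g (q.2 + r n * q.1 i)) := by
      refine (hφ.comp measurable_snd).mul (Finset.measurable_prod _ fun i _ => hφ.comp ?_)
      fun_prop
    have hGm' : Measurable fun z : Fin k → ℂ => Gint (fun x => ENNReal.ofReal (g x)) (r n) z := hGm.lintegral_prod_right
    exact hGm'.comp measurable_snd
  · intro n
    refine ae_of_all _ fun p => ?_
    by_cases hp : p ∈ Wset a T
    · have hp' := W_sub a hT hp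
      simp only [indicator_of_mem hp, indicator_of_mem hp', Pi.one_apply, one_mul]
      exact Gint_le hC hφ h1 _ _
    · simp [indicator_of_notMem hp]
  · rw [lintegral_indicator (MeasurableSet.univ.prod Metric.isClosed_closedBall.measurableSet), lintegral_const,
      Measure.restrict_apply_univ, Measure.prod_prod]
    refine ENNReal.mul_ne_top (ENNReal.pow_ne_top hCt) (ENNReal.mul_ne_top (measure_ne_top _ _) ?_)
    exact (isCompact_closedBall _ _).measure_lt_top.ne
  · refine ae_of_all _ fun p => ?_
    refine ENNReal.Tendsto.const_mul (Gint_tendsto hfc hfg hg hCt hC h1 r hr p.2) (Or.inr ?_)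
    by_cases hp : p ∈ Wset a T <;> simp [hp]

/-- uniform distribution of the inclinations -/
def Uni : Measure ℝ := (ENNReal.ofReal (2 * π))⁻¹ • volume.restrict (Set.Ico 0 (2 * π))

instance : IsProbabilityMeasure Uni := by
  constructor
  simp only [Uni, Measure.smul_apply, Measure.restrict_apply_univ, Real.volume_Ico, sub_zero, smul_eq_mul]
  refine ENNReal.inv_mul_cancel ?_ ENNReal.ofReal_ne_top
  simp [Real.pi_pos]

theorem pi_Uni (k : ℕ) : (Measure.pi fun _ : Fin k => Uni) =
    ((ENNReal.ofReal (2 * π))⁻¹ ^ k) • volume.restrict (Set.univ.pi (fun _ : Fin k => Set.Ico 0 (2 * π))) := by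
  refine Measure.pi_eq fun s hs => ?_
  rw [Measure.smul_apply, volume_pi, Measure.restrict_pi_pi, Measure.pi_pi]
  simp only [Uni, Measure.smul_apply, smul_eq_mul, Finset.prod_mul_distrib, Finset.prod_const,
    Finset.card_univ, Fintype.card_fin]

theorem muT_eq (f : ℂ → ℝ) (hf0 : ∀ x, 0 ≤ f x) (hfm : AEMeasurable f) (a : ℝ) {k : ℕ} {T : Fin (k+1) → Fin (k+1) → Prop}
    (hT : (SimpleGraph.fromRel T).Connected) :
    (((Measure.pi fun _ : Fin (k+1) => Uni).prod volume) (Wset a T) *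
        ∫⁻ x, ENNReal.ofReal (f x) ^ (k+1)).toReal = (k+1).factorial * muT a (k+1) T f := by
  have hWm := measurableSet_W a T
  have hF : (∫⁻ x, ENNReal.ofReal (f x) ^ (k+1)).toReal = ∫ x, f x ^ (k+1) := by
    rw [integral_eq_lintegral_of_nonneg_ae (ae_of_all _ fun x => pow_nonneg (hf0 x) _)
      (hfm.pow_const _).aestronglyMeasurable]
    simp_rw [ENNReal.ofReal_pow (hf0 _)]
  have hin : ∀ y : Fin (k+1) → ℝ, ∀ z : Fin (k+1-1) → ℂ, ∫ x : ℂ, hInd a T (pts z) y * f x ^ (k+1) =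
      hInd a T (pts z) y * ∫ x, f x ^ (k+1) := fun y z => integral_const_mul _ _
  have hz : ∀ y : Fin (k+1) → ℝ, ∫ z : Fin (k+1-1) → ℂ, hInd a T (pts z) y =
      (volume (Prod.mk y ⁻¹' Wset a T)).toReal := by
    intro y
    have hm : MeasurableSet (Prod.mk y ⁻¹' Wset a T) := measurable_prodMk_left hWm
    have : (fun z : Fin k → ℂ => hInd a T (pts (k := k+1) z) y) = (Prod.mk y ⁻¹' Wset a T).indicator 1 := by
      classical
      funext z
      simp [hInd, indicator_apply, Wset]
    rw [← measureReal_def, ← integral_indicator_one hm, ← this]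
    rfl
  have hfin : ∀ y : Fin (k+1) → ℝ, volume (Prod.mk y ⁻¹' Wset a T) < ⊤ := by
    intro y
    refine lt_of_le_of_lt (measure_mono ?_) (isCompact_closedBall (0 : Fin k → ℂ) ((k:ℝ)+1)).measure_lt_top
    intro z hz
    exact (W_sub a hT hz).2
  rw [ENNReal.toReal_mul, hF, Measure.prod_apply hWm, pi_Uni, lintegral_smul_measure, smul_eq_mul, ENNReal.toReal_mul]
  unfold muT
  simp_rw [hin, integral_mul_const, hz]
  rw [integral_toReal (measurable_measure_prodMk_left hWm).aemeasurable (ae_of_all _ hfin)]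
  have h2 : ((ENNReal.ofReal (2 * π))⁻¹ ^ (k + 1)).toReal = ((2 * π) ^ (k+1))⁻¹ := by
    rw [ENNReal.toReal_pow, ENNReal.toReal_inv, ENNReal.toReal_ofReal (by positivity), inv_pow]
  rw [h2]
  have : ((k+1).factorial : ℝ) ≠ 0 := by positivity
  have h3 : (2 * π) ^ (k+1) ≠ 0 := by positivity
  field_simp

theorem pn_tendsto (f : ℂ → ℝ) (hf0 : ∀ x, 0 ≤ f x) {C : ℝ} (hfb : ∀ x, f x ≤ C)
    (hfc : ∀ᵐ x : ℂ, ContinuousAt f x)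
    [IsProbabilityMeasure (volume.withDensity fun x => ENNReal.ofReal (f x))]
    (a : ℝ) {k : ℕ} {T : Fin (k+1) → Fin (k+1) → Prop}
    (hT : (SimpleGraph.fromRel T).Connected)
    (r : ℕ → ℝ) (hrp : ∀ n, 0 < r n) (hr : Tendsto r atTop (𝓝 0)) :
    Tendsto (fun n => (Measure.pi fun _ : Fin (k+1) =>
        (volume.withDensity fun x => ENNReal.ofReal (f x)).prod Uni).real
      {w | isoT a (r n) T (fun i => (w i).1) (fun i => (w i).2)} / r n ^ (2 * k)) atTop
      (𝓝 ((k+1).factorial * muT a (k+1) T f)) := by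
  have hfm := ae_measurable_of_ae_cont hfc
  set g : ℂ → ℝ := fun x => min (hfm.mk f x) C with hg
  have hgm : Measurable g := hfm.measurable_mk.min measurable_const
  have hfg : f =ᵐ[volume] g := by
    filter_upwards [hfm.ae_eq_mk] with x hx
    rw [hg]; simp only; rw [← hx, min_eq_left (hfb x)]
  have hφe : (fun x => ENNReal.ofReal (f x)) =ᵐ[volume] fun x => ENNReal.ofReal (g x) := by
    filter_upwards [hfg] with x hx
    rw [hx]
  have hmu := muT_eq f hf0 hfm a hT
  have hGG : ∫⁻ x, ENNReal.ofReal (f x) ^ (k+1) = ∫⁻ x, ENNReal.ofReal (g x) ^ (k+1) := by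
    refine lintegral_congr_ae ?_
    filter_upwards [hφe] with x hx
    rw [hx]
  have hwd := withDensity_congr_ae hφe
  rename_i hpm
  rw [hwd] at hpm ⊢
  have h1 : ∫⁻ x, ENNReal.ofReal (g x) = 1 := by
    have := hpm.measure_univ
    rwa [withDensity_apply _ MeasurableSet.univ, Measure.restrict_univ] at this
  have hC : ∀ x, ENNReal.ofReal (g x) ≤ ENNReal.ofReal C := fun x =>
    ENNReal.ofReal_le_ofReal (min_le_right _ _)
  have ht := int_tendsto hfc hfg hgm ENNReal.ofReal_ne_top hC h1 r hr a hT Uni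
  rw [← hmu, hGG]
  have hne : ((Measure.pi fun _ : Fin (k+1) => Uni).prod volume) (Wset a T) *
        ∫⁻ x, ENNReal.ofReal (g x) ^ (k+1) ≠ ⊤ := by
    refine ENNReal.mul_ne_top ?_ ?_
    · refine ne_top_of_le_ne_top ?_ (measure_mono (W_sub a hT))
      rw [Measure.prod_prod]
      exact ENNReal.mul_ne_top (measure_ne_top _ _) (isCompact_closedBall _ _).measure_lt_top.ne
    · refine ne_top_of_le_ne_top (b := ENNReal.ofReal C ^ k) (ENNReal.pow_ne_top ENNReal.ofReal_ne_top) ?_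
      have := Gint_le hC hgm.ennreal_ofReal h1 0 (0 : Fin k → ℂ)
      simpa [Gint, pow_succ, mul_comm] using this
  refine Tendsto.congr ?_ ((ENNReal.tendsto_toReal hne).comp ht)
  intro n
  have hp : 0 < r n ^ (2 * k) := pow_pos (hrp n) _
  rw [measureReal_def, pn_formula (fun x => ENNReal.ofReal (g x)) hgm.ennreal_ofReal Uni a (hrp n) T,
    ENNReal.toReal_mul, ENNReal.toReal_ofReal hp.le, mul_div_cancel_left₀ _ hp.ne']
  rfl

theorem ball_bound (f : ℂ → ℝ) {C : ℝ} (hfb : ∀ x, f x ≤ C) (hC : 0 ≤ C) (x : ℂ) {ρ : ℝ} (hρ : 0 ≤ ρ) :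
    ((volume.withDensity fun x => ENNReal.ofReal (f x)).prod Uni) {p | dist p.1 x ≤ ρ} ≤
      ENNReal.ofReal (C * π * ρ ^ 2) := by
  have : {p : ℂ × ℝ | dist p.1 x ≤ ρ} = Metric.closedBall x ρ ×ˢ univ := by
    ext p; simp [Metric.mem_closedBall]
  rw [this, Measure.prod_prod, measure_univ, mul_one, withDensity_apply _ Metric.isClosed_closedBall.measurableSet]
  calc _ ≤ ∫⁻ _ in Metric.closedBall x ρ, ENNReal.ofReal C :=
        lintegral_mono fun y => ENNReal.ofReal_le_ofReal (hfb y)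
    _ = ENNReal.ofReal (C * π * ρ ^ 2) := by
      rw [lintegral_const, Measure.restrict_apply_univ, Complex.volume_closedBall,
        ← ENNReal.ofReal_pow hρ]
      have : ((NNReal.pi : NNReal) : ℝ≥0∞) = ENNReal.ofReal π := by
        rw [← NNReal.coe_real_pi, ENNReal.ofReal_coe_nnreal]
      rw [this, ← ENNReal.ofReal_mul (by positivity), ← ENNReal.ofReal_mul (by positivity)]
      congr 1; ring

theorem choose_m (k j : ℕ) (e : ℕ → ℝ) (he : ∀ n, 0 ≤ e n) (he0 : Tendsto e atTop (𝓝 0))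
    (hlog : (fun n : ℕ => Real.log n) =o[atTop] fun n : ℕ => (n:ℝ) * e n ^ (2 * j))
    (Q : ℝ) (hQ : 0 ≤ Q) (D : ℕ) :
    ∃ m : ℕ → ℕ, (∀ n, 1 ≤ m n) ∧ (∀ᶠ n : ℕ in atTop, (n:ℝ) ^ (k+1) * (Q * e n) ^ (m n) ≤ 1) ∧
      ∀ K : ℝ, 0 ≤ K → ∀ᶠ n : ℕ in atTop,
        K * (((D:ℝ) * m n + 1) * (m n : ℝ) ^ k) ^ 2 * Real.log n ≤ (n:ℝ) * e n ^ (2 * j) := by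
  classical
  set m0 : ℕ := 4 * j * (2 * (k+1)) with hm0
  set mb : ℕ → ℕ := fun n => ⌈((k:ℝ)+1) * Real.log n⌉₊ with hmb
  refine ⟨fun n => if (n:ℝ) * e n ^ (4 * j) ≤ 1 then m0 + 1 else mb n + 1, ?_, ?_, ?_⟩
  · intro n; dsimp only; split_ifs <;> omega
  · have h1 : ∀ᶠ n : ℕ in atTop, Q * e n ≤ Real.exp (-1) := by
      have : Tendsto (fun n => Q * e n) atTop (𝓝 (Q * 0)) := he0.const_mul Q
      rw [mul_zero] at this
      exact this.eventually_le_const (Real.exp_pos _)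
    have h2 : ∀ᶠ n : ℕ in atTop, Q ^ m0 ≤ (n:ℝ) := tendsto_natCast_atTop_atTop.eventually_ge_atTop _
    filter_upwards [h1, h2, eventually_ge_atTop 1] with n h1 h2 hn
    have hn1 : (1:ℝ) ≤ n := by exact_mod_cast hn
    have hn0 : (0:ℝ) < n := by linarith
    have hQe : 0 ≤ Q * e n := mul_nonneg hQ (he n)
    have hQe1 : Q * e n ≤ 1 := h1.trans (Real.exp_le_one_iff.2 (by norm_num))
    split_ifs with hc
    · have ha : (n:ℝ) ^ (2 * (k+1)) * e n ^ m0 ≤ 1 := by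
        have := pow_le_one₀ (n := 2 * (k+1)) (mul_nonneg hn0.le (pow_nonneg (he n) _)) hc
        rwa [mul_pow, ← pow_mul, ← hm0] at this
      have hb : (Q * e n) ^ (m0 + 1) ≤ (Q * e n) ^ m0 := pow_le_pow_of_le_one hQe hQe1 (by omega)
      have hc' : Q ^ m0 ≤ (n:ℝ) ^ (k+1) := h2.trans (le_self_pow₀ hn1 (by omega))
      calc (n:ℝ) ^ (k+1) * (Q * e n) ^ (m0+1) ≤ (n:ℝ) ^ (k+1) * (Q * e n) ^ m0 := by gcongr
        _ = Q ^ m0 * ((n:ℝ) ^ (k+1) * e n ^ m0) := by rw [mul_pow]; ring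
        _ ≤ (n:ℝ) ^ (k+1) * ((n:ℝ) ^ (k+1) * e n ^ m0) := by
            gcongr
            exact mul_nonneg (by positivity) (pow_nonneg (he n) _)
        _ = (n:ℝ) ^ (2 * (k+1)) * e n ^ m0 := by ring
        _ ≤ 1 := ha
    · have hle : ((k:ℝ)+1) * Real.log n ≤ (mb n : ℝ) := Nat.le_ceil _
      have hb : (Q * e n) ^ (mb n + 1) ≤ Real.exp (-(((k:ℝ)+1) * Real.log n)) := by
        calc (Q * e n) ^ (mb n + 1) ≤ (Q * e n) ^ (mb n) := pow_le_pow_of_le_one hQe hQe1 (by omega)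
          _ ≤ (Real.exp (-1)) ^ (mb n) := by gcongr
          _ = Real.exp (-(mb n : ℝ)) := by rw [← Real.exp_nat_mul]; congr 1; ring
          _ ≤ _ := Real.exp_le_exp.2 (by linarith)
      have hx : (n:ℝ) ^ (k+1) = Real.exp (((k:ℝ)+1) * Real.log n) := by
        rw [show ((k:ℝ)+1) = ((k+1 : ℕ) : ℝ) by push_cast; ring, Real.exp_nat_mul, Real.exp_log hn0]
      calc _ ≤ (n:ℝ) ^ (k+1) * Real.exp (-(((k:ℝ)+1) * Real.log n)) := by gcongr
        _ = 1 := by rw [hx, ← Real.exp_add]; simp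
  · intro K hK
    set K1 : ℝ := K * (((D:ℝ) * (m0 + 1 : ℕ) + 1) * ((m0 + 1 : ℕ) : ℝ) ^ k) ^ 2 with hK1
    have hK1n : 0 ≤ K1 := by positivity
    have ha : ∀ᶠ n : ℕ in atTop, K1 * Real.log n ≤ (n:ℝ) * e n ^ (2 * j) := by
      have := hlog.bound (c := (K1 + 1)⁻¹) (by positivity)
      filter_upwards [this, eventually_ge_atTop 1] with n hn hn1
      have hn1 : (1:ℝ) ≤ n := by exact_mod_cast hn1
      have hl := Real.log_nonneg hn1
      rw [Real.norm_of_nonneg hl, Real.norm_of_nonneg (mul_nonneg (by linarith) (pow_nonneg (he n) _)),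
        inv_mul_eq_div, le_div_iff₀ (by positivity)] at hn
      nlinarith
    set c0 : ℝ := K * (((D:ℝ) * (k+3) + 1) * ((k:ℝ) + 3) ^ k) ^ 2 with hc0
    have hc0n : 0 ≤ c0 := by positivity
    have hb : ∀ᶠ n : ℕ in atTop, (c0 * Real.log n ^ (2 * (k+1) + 1)) ^ 2 ≤ (n:ℝ) := by
      have h := (isLittleO_pow_log_id_atTop (n := (2 * (k+1) + 1) * 2)).comp_tendsto
        (tendsto_natCast_atTop_atTop (R := ℝ))
      have := h.bound (c := (c0 ^ 2 + 1)⁻¹) (by positivity)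
      filter_upwards [this, eventually_ge_atTop 1] with n hn hn1
      have hn1 : (1:ℝ) ≤ n := by exact_mod_cast hn1
      have hl := Real.log_nonneg hn1
      simp only [Function.comp, id] at hn
      rw [Real.norm_of_nonneg (pow_nonneg hl _), Real.norm_of_nonneg (by linarith),
        inv_mul_eq_div, le_div_iff₀ (by positivity)] at hn
      rw [mul_pow, ← pow_mul]
      nlinarith [pow_nonneg hl ((2 * (k+1) + 1) * 2)]
    have hl1 : ∀ᶠ n : ℕ in atTop, 1 ≤ Real.log n :=
      (Real.tendsto_log_atTop.comp tendsto_natCast_atTop_atTop).eventually_ge_atTop 1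
    filter_upwards [ha, hb, hl1, eventually_ge_atTop 1] with n ha hb hl1 hn1
    have hn1 : (1:ℝ) ≤ n := by exact_mod_cast hn1
    split_ifs with hc
    · exact ha
    · push Not at hc
      have hm : ((mb n + 1 : ℕ) : ℝ) ≤ ((k:ℝ) + 3) * Real.log n := by
        have := Nat.ceil_lt_add_one (a := ((k:ℝ)+1) * Real.log n) (by positivity)
        push_cast
        have h' : (mb n : ℝ) < ((k:ℝ)+1) * Real.log n + 1 := this
        nlinarith
      have h1 : K * (((D:ℝ) * ((mb n + 1 : ℕ) : ℝ) + 1) * ((mb n + 1 : ℕ) : ℝ) ^ k) ^ 2 * Real.log n ≤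
          c0 * Real.log n ^ (2 * (k+1) + 1) := by
        calc _ ≤ K * (((D:ℝ) * (((k:ℝ) + 3) * Real.log n) + Real.log n) * (((k:ℝ) + 3) * Real.log n) ^ k) ^ 2 * Real.log n := by
              gcongr
          _ = _ := by rw [hc0, mul_pow ((k:ℝ)+3) (Real.log n) k]; ring
      refine h1.trans ?_
      have hB : 0 ≤ (n:ℝ) * e n ^ (2 * j) := mul_nonneg (by linarith) (pow_nonneg (he n) _)
      refine le_of_sq_le_sq ?_ hB
      refine hb.trans ?_
      have : ((n:ℝ) * e n ^ (2 * j)) ^ 2 = n * (n * e n ^ (4 * j)) := by ring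
      rw [this]
      nlinarith

theorem r_tendsto (r : ℕ → ℝ) (hrpos : ∀ n, 0 < r n)
    (hr0 : Tendsto (fun n : ℕ => (n : ℝ) * r n ^ 2) atTop (𝓝 0)) : Tendsto r atTop (𝓝 0) := by
  have h2 : Tendsto (fun n => r n ^ 2) atTop (𝓝 0) := by
    refine tendsto_of_tendsto_of_tendsto_of_le_of_le' tendsto_const_nhds hr0
      (Eventually.of_forall fun n => sq_nonneg _) ?_
    filter_upwards [eventually_ge_atTop 1] with n hn
    have hn1 : (1:ℝ) ≤ n := by exact_mod_cast hn
    nlinarith [sq_nonneg (r n)]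
  have h3 := (Real.continuous_sqrt.tendsto 0).comp h2
  rw [Real.sqrt_zero] at h3
  refine h3.congr fun n => ?_
  simp [Real.sqrt_sq (hrpos n).le]

theorem bc {Ω : Type*} [MeasurableSpace Ω] (P : Measure Ω) (F : ℕ → Ω → ℝ) (E M : ℕ → ℝ)
    (μ : ℝ) (hM : ∀ᶠ n in atTop, 0 < M n) (hE : Tendsto (fun n => E n / M n) atTop (𝓝 μ))
    (h : ∀ δ : ℝ, 0 < δ → ∀ᶠ n : ℕ in atTop,
      P {ω | δ * M n ≤ |F n ω - E n|} ≤ ENNReal.ofReal (3 * (1 / (n:ℝ) ^ 2))) :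
    ∀ᵐ ω ∂P, Tendsto (fun n => F n ω / M n) atTop (𝓝 μ) := by
  have hδ : ∀ j : ℕ, ∀ᵐ ω ∂P, ∀ᶠ n in atTop, |F n ω - E n| < (1 / ((j:ℝ) + 1)) * M n := by
    intro j
    obtain ⟨N, hN⟩ := eventually_atTop.1 (h (1 / ((j:ℝ)+1)) (by positivity))
    have hs : (∑' n, P {ω | N ≤ n ∧ (1 / ((j:ℝ) + 1)) * M n ≤ |F n ω - E n|}) ≠ ⊤ := by
      have hsum : Summable fun n : ℕ => 3 * (1 / (n:ℝ) ^ 2) :=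
        (Real.summable_one_div_nat_pow.2 (by norm_num)).mul_left 3
      refine ne_top_of_le_ne_top hsum.tsum_ofReal_ne_top (ENNReal.tsum_le_tsum fun n => ?_)
      by_cases hn : N ≤ n
      · refine le_trans (measure_mono ?_) (hN n hn)
        intro ω hω
        exact hω.2
      · simp [hn]
    filter_upwards [ae_eventually_notMem hs] with ω hω
    filter_upwards [hω, eventually_ge_atTop N] with n hn hN
    by_contra hc
    exact hn ⟨hN, not_lt.1 hc⟩
  rw [← ae_all_iff] at hδ
  filter_upwards [hδ] with ω hω
  have h0 : Tendsto (fun n => F n ω / M n - E n / M n) atTop (𝓝 0) := by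
    rw [Metric.tendsto_atTop']
    intro ε hε
    obtain ⟨j, hj⟩ := exists_nat_one_div_lt hε
    obtain ⟨N, hN⟩ := eventually_atTop.1 ((hω j).and hM)
    refine ⟨N, fun n hn => ?_⟩
    obtain ⟨h1, h2⟩ := hN n hn.le
    rw [Real.dist_eq, sub_zero, ← sub_div, abs_div, abs_of_pos h2, div_lt_iff₀ h2]
    refine h1.trans ?_
    gcongr
  simpa using h0.add hE

theorem M_tendsto (k : ℕ) (r : ℕ → ℝ) (hrpos : ∀ n, 0 < r n)
    (hlog : (fun n : ℕ => Real.log n) =o[atTop] fun n : ℕ => (n:ℝ) * ((n:ℝ) * r n ^ 2) ^ (2 * k)) :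
    Tendsto (fun n : ℕ => (n:ℝ) ^ (k+1) * r n ^ (2 * k)) atTop atTop := by
  have h1 := hlog.bound (c := 1) one_pos
  have hl1 : ∀ᶠ n : ℕ in atTop, 1 ≤ Real.log n :=
      (Real.tendsto_log_atTop.comp tendsto_natCast_atTop_atTop).eventually_ge_atTop 1
  refine tendsto_atTop_mono' _ ?_ (Real.tendsto_sqrt_atTop.comp tendsto_natCast_atTop_atTop)
  filter_upwards [h1, hl1] with n h1 hl1
  have hr := hrpos n
  rw [Real.norm_of_nonneg (by linarith), Real.norm_of_nonneg (by positivity), one_mul] at h1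
  refine Real.sqrt_le_iff.2 ⟨by positivity, ?_⟩
  have : ((n:ℝ) ^ (k+1) * r n ^ (2 * k)) ^ 2 = n * ((n:ℝ) * ((n:ℝ) * r n ^ 2) ^ (2 * k)) := by
    rw [mul_pow (n:ℝ) (r n ^ 2)]; ring
  rw [this]
  have hn : (0:ℝ) ≤ n := by positivity
  nlinarith

theorem mean_tendsto (f : ℂ → ℝ) (hf0 : ∀ x, 0 ≤ f x) {C : ℝ} (hC : 0 ≤ C) (hfb : ∀ x, f x ≤ C)
    (hfc : ∀ᵐ x : ℂ, ContinuousAt f x)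
    [IsProbabilityMeasure (volume.withDensity fun x => ENNReal.ofReal (f x))]
    (a : ℝ) {k : ℕ} (hk : 1 ≤ k) {T : Fin (k+1) → Fin (k+1) → Prop}
    (hT : (SimpleGraph.fromRel T).Connected)
    (r : ℕ → ℝ) (hrpos : ∀ n, 0 < r n)
    (hr0 : Tendsto (fun n : ℕ => (n : ℝ) * r n ^ 2) atTop (𝓝 0))
    (hM : Tendsto (fun n : ℕ => (n:ℝ) ^ (k+1) * r n ^ (2 * k)) atTop atTop)
    (m : ℕ → ℕ) (hm : ∀ᶠ n : ℕ in atTop,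
      (n:ℝ) ^ (k+1+1) * ((C * π * ((k:ℝ)+1+1) ^ 2) * ((n : ℝ) * r n ^ 2)) ^ (m n) ≤ 1) :
    Tendsto (fun n : ℕ => (∫ w, ((Fam a (r n) T (m n) w).card : ℝ) ∂(Measure.pi fun _ : Fin n =>
        (volume.withDensity fun x => ENNReal.ofReal (f x)).prod Uni)) /
        ((n:ℝ) ^ (k+1) * r n ^ (2 * k))) atTop (𝓝 (muT a (k+1) T f)) := by
  set ν := (volume.withDensity fun x => ENNReal.ofReal (f x)).prod Uni with hν
  set A : ℝ := C * π * ((k:ℝ)+1+1) ^ 2 with hA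
  have hA0 : 0 ≤ A := by positivity
  have hp := pn_tendsto f hf0 hfb hfc a hT r hrpos (r_tendsto r hrpos hr0)
  rw [← hν] at hp
  set p : ℕ → ℝ := fun n => (Measure.pi fun _ : Fin (k+1) => ν).real
    {w | isoT a (r n) T (fun i => (w i).1) (fun i => (w i).2)} with hpdef
  set E : ℕ → ℝ := fun n => ∫ w, ((Fam a (r n) T (m n) w).card : ℝ) ∂(Measure.pi fun _ : Fin n => ν) with hE
  have hch : Tendsto (fun n : ℕ => (n.choose (k+1) : ℝ) / ((n:ℝ) ^ (k+1))) atTop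
      (𝓝 (1 / (k+1).factorial)) := by
    have h := (Asymptotics.isEquivalent_iff_tendsto_one ?_).1 (isEquivalent_choose (k+1))
    · have h2 := h.div_const ((k+1).factorial : ℝ)
      refine h2.congr' ?_
      filter_upwards [eventually_ge_atTop 1] with n hn
      have hn1 : (n:ℝ) ≠ 0 := by positivity
      have hf : ((k+1).factorial : ℝ) ≠ 0 := by positivity
      simp only [Pi.div_apply]
      field_simp
    · filter_upwards [eventually_ge_atTop 1] with n hn
      positivity
  have hmain : Tendsto (fun n : ℕ => (n.choose (k+1) : ℝ) / ((n:ℝ) ^ (k+1)) * (p n / r n ^ (2 * k))) atTop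
      (𝓝 (muT a (k+1) T f)) := by
    have := hch.mul hp
    have hf : ((k+1).factorial : ℝ) ≠ 0 := by positivity
    rwa [← mul_assoc, one_div_mul_cancel hf, one_mul] at this
  have herr : Tendsto (fun n : ℕ => A ^ (k+1) * ((n:ℝ) * r n ^ 2) + 1 / ((n:ℝ) ^ (k+1) * r n ^ (2 * k)))
      atTop (𝓝 0) := by
    have h1 := hr0.const_mul (A ^ (k+1))
    have h2 := hM.inv_tendsto_atTop
    have := h1.add h2
    simpa using this
  have hdiff : Tendsto (fun n : ℕ => E n / ((n:ℝ) ^ (k+1) * r n ^ (2 * k)) -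
      (n.choose (k+1) : ℝ) / ((n:ℝ) ^ (k+1)) * (p n / r n ^ (2 * k))) atTop (𝓝 0) := by
    refine squeeze_zero_norm' ?_ herr
    filter_upwards [hm, hM.eventually_gt_atTop 0, eventually_ge_atTop 1] with n hm hM hn
    have hr := hrpos n
    have hn0 : (0:ℝ) < n := by exact_mod_cast hn
    have hme := mean_est ν (a := a) hr n (m n) (by omega) hT (A * r n ^ 2) (by positivity)
      (fun x => by
        have := ball_bound f hfb hC x (ρ := ((k+1 : ℕ) + 1) * r n) (by positivity)
        refine this.trans (le_of_eq ?_)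
        congr 1; rw [hA]; push_cast; ring)
    have heq : E n / ((n:ℝ) ^ (k+1) * r n ^ (2 * k)) -
      (n.choose (k+1) : ℝ) / ((n:ℝ) ^ (k+1)) * (p n / r n ^ (2 * k)) =
      (E n - n.choose (k+1) * p n) / ((n:ℝ) ^ (k+1) * r n ^ (2 * k)) := by
      field_simp
    rw [heq, Real.norm_eq_abs, abs_div, abs_of_pos hM]
    refine (div_le_div_of_nonneg_right hme hM.le).trans ?_
    rw [div_le_iff₀ hM, add_mul, one_div_mul_cancel hM.ne', mul_add]
    refine add_le_add (le_of_eq ?_) ?_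
    · rw [mul_pow]; ring
    · refine le_trans (le_of_eq ?_) hm
      have : (n:ℝ) * (A * r n ^ 2) = A * (n * r n ^ 2) := by ring
      rw [this]; ring
  simpa using hdiff.add hmain

end

/-- Theorem 3: strong law of large numbers for the number of isolated induced
`T`-subdigraphs in the regime `n rₙ² → 0`, `ln n = o(n^{2k-1} rₙ^{4(k-1)})`. -/
theorem statement2
    {Ω : Type} [MeasureSpace Ω] [IsProbabilityMeasure (ℙ : Measure Ω)]
    -- the common density of the points, bounded and a.e. continuous
    (f : ℂ → ℝ) (hf0 : ∀ x, 0 ≤ f x) (hfb : ∃ C, ∀ x, f x ≤ C)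
    (hfc : ∀ᵐ x : ℂ, ContinuousAt f x)
    -- the central angle α ∈ (0, 2π]
    (a : ℝ) (ha : 0 < a) (ha' : a ≤ 2 * π)
    -- `Z i = (Xᵢ, Yᵢ)`: i.i.d., `Xᵢ` with density `f`, `Yᵢ` uniform on `[0, 2π)`,
    -- the `Xᵢ` independent of the `Yᵢ`
    (Z : ℕ → Ω → ℂ × ℝ) (hZm : ∀ i, Measurable (Z i))
    (hZi : iIndepFun Z ℙ)
    (hZd : ∀ i, Measure.map (Z i) ℙ =
      (volume.withDensity fun x => ENNReal.ofReal (f x)).prod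
        ((ENNReal.ofReal (2 * π))⁻¹ • volume.restrict (Set.Ico 0 (2 * π))))
    -- `T` a feasible connected digraph of order `k`
    (k : ℕ) (hk : 2 ≤ k) (T : Fin k → Fin k → Prop) (hTirr : ∀ i, ¬ T i i)
    (hTconn : (SimpleGraph.fromRel T).Connected)
    (hTfeas : ∃ ρ : ℝ, 0 < ρ ∧
      0 < ℙ {ω | isoT a ρ T (fun i : Fin k => (Z i ω).1) (fun i : Fin k => (Z i ω).2)})
    -- the positive cutoffs
    (r : ℕ → ℝ) (hrpos : ∀ n, 0 < r n)
    (hr0 : Tendsto (fun n : ℕ => (n : ℝ) * r n ^ 2) atTop (𝓝 0))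
    (hlog : (fun n : ℕ => Real.log n) =o[atTop]
      (fun n : ℕ => (n : ℝ) ^ (2 * k - 1) * r n ^ (4 * (k - 1)))) :
    ∀ᵐ ω ∂ℙ, Tendsto (fun n : ℕ =>
        (isolatedCount a (r n) T
          (fun i : Fin n => (Z i ω).1) (fun i : Fin n => (Z i ω).2) : ℝ) /
          ((n : ℝ) ^ k * r n ^ (2 * (k - 1))))
      atTop (𝓝 (muT a k T f)) := by
  obtain ⟨k, rfl⟩ : ∃ j, k = j + 1 := ⟨k - 1, by omega⟩
  have hk1 : 1 ≤ k := by omega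
  simp only [Nat.add_sub_cancel] at hlog ⊢
  obtain ⟨C, hfb⟩ := hfb
  have hC : 0 ≤ C := (hf0 0).trans (hfb 0)
  obtain ⟨D, hD⟩ := exists_cover
  change ∀ i, Measure.map (Z i) ℙ =
      (volume.withDensity fun x => ENNReal.ofReal (f x)).prod Uni at hZd
  have hprob : IsProbabilityMeasure (volume.withDensity fun x => ENNReal.ofReal (f x)) := by
    constructor
    have h1 : Measure.map (Z 0) ℙ univ = 1 := by
      rw [Measure.map_apply (hZm 0) MeasurableSet.univ, preimage_univ, measure_univ]
    rw [hZd 0, ← univ_prod_univ, Measure.prod_prod, measure_univ (μ := Uni), mul_one] at h1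
    exact h1
  set e : ℕ → ℝ := fun n => (n:ℝ) * r n ^ 2 with he
  have he0 : ∀ n, 0 ≤ e n := fun n => by positivity
  have hBe : ∀ n : ℕ, (n : ℝ) ^ (2 * (k+1) - 1) * r n ^ (4 * k) = (n:ℝ) * e n ^ (2 * k) := by
    intro n
    have : 2 * (k+1) - 1 = 2 * k + 1 := by omega
    rw [this, he]; simp only; rw [mul_pow]; ring
  simp_rw [hBe] at hlog
  set A : ℝ := C * π * ((k:ℝ)+1+1) ^ 2 with hA
  have hA0 : 0 ≤ A := by positivity
  obtain ⟨m, hm1, hm2, hm3⟩ := choose_m (k+1) k e he0 hr0 hlog A hA0 D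
  have hM := M_tendsto k r hrpos hlog
  have hmean := mean_tendsto f hf0 hC hfb hfc a hk1 hTconn r hrpos hr0 hM m hm2
  set ν := (volume.withDensity fun x => ENNReal.ofReal (f x)).prod Uni with hν
  refine bc ℙ (fun n ω => (isolatedCount a (r n) T
          (fun i : Fin n => (Z i ω).1) (fun i : Fin n => (Z i ω).2) : ℝ)) _ _ _
    (hM.eventually_gt_atTop 0) hmean ?_
  intro δ hδ
  filter_upwards [hm2, hm3 (4 / δ ^ 2) (by positivity), hM.eventually_gt_atTop 0,
    eventually_ge_atTop 1] with n h2 h3 hMn hn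
  have hr := hrpos n
  have hn1 : (1:ℝ) ≤ n := by exact_mod_cast hn
  have hn0 : (0:ℝ) < n := by linarith
  set En : ℝ := ∫ w, ((Fam a (r n) T (m n) w).card : ℝ) ∂(Measure.pi fun _ : Fin n => ν) with hEn
  set M : ℝ := (n:ℝ) ^ (k+1) * r n ^ (2 * k) with hMdef
  set W : Ω → Fin n → ℂ × ℝ := fun ω i => Z i ω with hW
  have hWm : Measurable W := measurable_pi_lambda _ fun i => hZm i
  have hWlaw : Measure.map W ℙ = Measure.pi fun _ : Fin n => ν := by
    have h := hZi.precomp (g := fun i : Fin n => (i : ℕ)) Fin.val_injective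
    rw [iIndepFun_iff_map_fun_eq_pi_map (fun i => (hZm _).aemeasurable)] at h
    refine h.trans ?_
    congr 1
    funext i
    exact hZd i
  set B1 : Set (Fin n → ℂ × ℝ) := {w | ∃ i, m n < (nb (((k+1 : ℕ) + 1) * r n) w i).card} with hB1
  set B2 : Set (Fin n → ℂ × ℝ) := {w | δ * M ≤ |((Fam a (r n) T (m n) w).card : ℝ) - En|} with hB2
  have hB1m : MeasurableSet B1 := by
    refine measurableSet_setOfPred.2 (Measurable.exists fun i => ?_)
    exact measurableSet_setOfPred.1 (measurableSet_lt measurable_const (measurable_nb _ i))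
  have hB2m : MeasurableSet B2 :=
    measurableSet_le measurable_const ((measurable_Fam a (r n) T (m n)).sub_const En).abs
  have hsub : {ω | δ * M ≤ |(isolatedCount a (r n) T
          (fun i : Fin n => (Z i ω).1) (fun i : Fin n => (Z i ω).2) : ℝ) - En|} ⊆ W ⁻¹' (B1 ∪ B2) := by
    intro ω hω
    by_cases hb : W ω ∈ B1
    · exact Or.inl hb
    · refine Or.inr ?_
      have hb' : ∀ i, (nb (((k+1 : ℕ) + 1) * r n) (W ω) i).card ≤ m n := by
        intro i
        by_contra hc
        exact hb ⟨i, not_le.1 hc⟩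
      have := isolatedCount_eq a (r n) T (W ω) (m n) hb'
      simp only [hB2, mem_ofPred_eq]
      rw [← this]
      exact hω
  refine (measure_mono hsub).trans ?_
  rw [← Measure.map_apply hWm (hB1m.union hB2m), hWlaw]
  refine (measure_union_le _ _).trans ?_
  have hn2 : (0:ℝ) < 1 / (n:ℝ) ^ 2 := by positivity
  have hb1 : (Measure.pi fun _ : Fin n => ν) B1 ≤ ENNReal.ofReal (1 / (n:ℝ) ^ 2) := by
    have h := bad_le ν (((k+1 : ℕ) + 1) * r n) (ENNReal.ofReal (A * r n ^ 2)) (fun x => by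
        have := ball_bound f hfb hC x (ρ := ((k+1 : ℕ) + 1) * r n) (by positivity)
        refine this.trans (le_of_eq ?_)
        congr 1; rw [hA]; push_cast; ring) n (m n)
    refine h.trans ?_
    rw [← ENNReal.ofReal_natCast, ← ENNReal.ofReal_mul hn0.le, ← ENNReal.ofReal_pow (by positivity),
      ← ENNReal.ofReal_mul hn0.le]
    refine ENNReal.ofReal_le_ofReal ?_
    rw [le_div_iff₀ (by positivity)]
    have h4 : (n:ℝ) * (A * r n ^ 2) = A * e n := by rw [he]; ring
    rw [h4]
    refine le_trans ?_ h2
    have hAe : 0 ≤ (A * e n) ^ m n := pow_nonneg (mul_nonneg hA0 (he0 n)) _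
    calc (n:ℝ) * (A * e n) ^ m n * (n:ℝ) ^ 2 = (n:ℝ) ^ 3 * (A * e n) ^ m n := by ring
      _ ≤ (n:ℝ) ^ (k+1+1) * (A * e n) ^ m n := by
        refine mul_le_mul_of_nonneg_right ?_ hAe
        exact pow_le_pow_right₀ hn1 (by omega)
  have hb2 : (Measure.pi fun _ : Fin n => ν) B2 ≤ ENNReal.ofReal (2 * (1 / (n:ℝ) ^ 2)) := by
    rw [← ENNReal.ofReal_toReal (measure_ne_top (Measure.pi fun _ : Fin n => ν) B2)]
    refine ENNReal.ofReal_le_ofReal ?_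
    have h := Fam_conc ν hD (a := a) hr n (by omega) hTconn (m n) (δ * M) (by positivity)
    refine h.trans ?_
    refine mul_le_mul_of_nonneg_left ?_ (by norm_num)
    have hc : (0:ℝ) < ((D:ℝ) * m n + 1) * (m n : ℝ) ^ (k+1) := by
      have : (0:ℝ) < m n := by exact_mod_cast hm1 n
      positivity
    set c : ℝ := ((D:ℝ) * m n + 1) * (m n : ℝ) ^ (k+1) with hcdef
    have h5 : 1 / (n:ℝ) ^ 2 = Real.exp (-(2 * Real.log n)) := by
      rw [Real.exp_neg, show (2:ℝ) = ((2:ℕ):ℝ) by norm_num, Real.exp_nat_mul, Real.exp_log hn0, one_div]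
    rw [h5]
    refine Real.exp_le_exp.2 ?_
    rw [neg_div, neg_le_neg_iff, le_div_iff₀ (by positivity)]
    have h6 : M ^ 2 = n * ((n:ℝ) * e n ^ (2 * k)) := by
      rw [hMdef, he]; simp only; rw [mul_pow (n:ℝ) (r n ^ 2)]; ring
    rw [mul_pow δ M, h6]
    have h7 : 4 * c ^ 2 * Real.log n ≤ δ ^ 2 * ((n:ℝ) * e n ^ (2 * k)) := by
      have := mul_le_mul_of_nonneg_left h3 (sq_nonneg δ)
      refine le_trans (le_of_eq ?_) this
      field_simp
    calc 2 * Real.log n * (2 * (n * c ^ 2)) = n * (4 * c ^ 2 * Real.log n) := by ring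
      _ ≤ n * (δ ^ 2 * ((n:ℝ) * e n ^ (2 * k))) := by gcongr
      _ = _ := by ring
  calc _ ≤ ENNReal.ofReal (1 / (n:ℝ) ^ 2) + ENNReal.ofReal (2 * (1 / (n:ℝ) ^ 2)) := add_le_add hb1 hb2
    _ = _ := by
      rw [← ENNReal.ofReal_add (by positivity) (by positivity)]
      congr 1; ring

end
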